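/- Let c₁ := 3^900·(3/2)^(5/3). For every integer a ≥ 7 for which the ring of integers of the simplest cubic field K_a equals ℤ[ρ], and for every real number x with x ≥ c₁³·a⁶·(log a)⁴, one has ((log a)²/a²)·x ≤ P(a, x) ≤ 7·((log a)²/a²)·x. -/

import Mathlib

open NumberField

/-- The largest real root of `X³ - aX² - (a+3)X - 1` (for `a ≥ 7` this set of real roots
is nonempty and bounded above, so `sSup` picks out the largest root). -/
noncomputable def simplestCubicRoot (a : ℤ) : ℝ :=
  sSup {x : ℝ | x ^ 3 - (a : ℝ) * x ^ 2 - ((a : ℝ) + 3) * x - 1 = 0}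

open MeasureTheory

/-- The volume of the image of a set under a map acting coordinatewise. -/
theorem volume_image_coordinatewise {ι : Type*} [Fintype ι] {f f' : ι → ℝ → ℝ}
    (hf : ∀ i x, HasDerivAt (f i) (f' i x) x) (hinj : ∀ i, Function.Injective (f i))
    {D : Set (ι → ℝ)} (hD : MeasurableSet D) :
    volume ((fun (v : ι → ℝ) i => f i (v i)) '' D) =
      ∫⁻ v in D, ENNReal.ofReal |∏ i, f' i (v i)| := by
  classical
  let F' : (ι → ℝ) → ((ι → ℝ) →L[ℝ] (ι → ℝ)) := fun v => .pi fun i =>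
    (ContinuousLinearMap.smulRight (1 : ℝ →L[ℝ] ℝ) (f' i (v i))).comp (.proj i)
  have hF : ∀ v, HasFDerivAt (fun (v : ι → ℝ) i => f i (v i)) (F' v) v := by
    intro v
    refine hasFDerivAt_pi.2 fun i => ?_
    exact (hf i (v i)).hasFDerivAt.comp v (hasFDerivAt_apply i v)
  have key := lintegral_image_eq_lintegral_abs_det_fderiv_mul volume hD
    (fun v _ => (hF v).hasFDerivWithinAt)
    (fun v _ w _ h => funext fun i => hinj i (congrFun h i)) (fun _ => 1)
  simp only [lintegral_const, one_mul, mul_one, Measure.restrict_apply MeasurableSet.univ,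
    Set.univ_inter] at key
  rw [key]
  refine lintegral_congr fun v => ?_
  congr 2
  simp_rw [F', ContinuousLinearMap.det, ContinuousLinearMap.coe_pi,
    ContinuousLinearMap.toLinearMap_comp, ContinuousLinearMap.coe_proj, LinearMap.det_pi,
    LinearMap.det_ring, ContinuousLinearMap.coe_coe, ContinuousLinearMap.smulRight_apply]
  simp

/-- The part of an orthant where given linear forms of the logarithms of the coordinates lie in
a given box. -/
def logBox (s : Fin 3 → ℝ) (T : Matrix (Fin 3) (Fin 3) ℝ) (lo hi : Fin 3 → ℝ) :
    Set (Fin 3 → ℝ) :=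
  {z | (∀ i, 0 < s i * z i) ∧ T.mulVec (fun i => Real.log (z i)) ∈ Set.Icc lo hi}

theorem volume_logBox {s : Fin 3 → ℝ} (hs : ∀ i, |s i| = 1) {T : Matrix (Fin 3) (Fin 3) ℝ}
    (hT : T 0 = fun _ => 1) (hdet : T.det ≠ 0) {lo hi : Fin 3 → ℝ} (h : lo ≤ hi) :
    volume (logBox s T lo hi) = ENNReal.ofReal
      ((Real.exp (hi 0) - Real.exp (lo 0)) * (hi 1 - lo 1) * (hi 2 - lo 2) / |T.det|) := by
  have hs0 : ∀ i, s i ≠ 0 := fun i h0 => by simpa [h0] using hs i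
  have hss : ∀ i, s i * s i = 1 := fun i => by rw [← abs_mul_abs_self, hs]; norm_num
  have himg : logBox s T lo hi = (fun (v : Fin 3 → ℝ) i => s i * Real.exp (v i)) ''
      (T.toLin' ⁻¹' Set.Icc lo hi) := by
    ext z
    simp only [logBox, Set.mem_ofPred_eq, Set.mem_image, Set.mem_preimage, Matrix.toLin'_apply]
    constructor
    · rintro ⟨hz, hb⟩
      refine ⟨_, hb, funext fun i => ?_⟩
      have hz0 : z i ≠ 0 := fun h0 => by simpa [h0] using hz i
      rw [Real.exp_log_eq_abs hz0, ← one_mul |z i|, ← hs i, ← abs_mul, abs_of_pos (hz i),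
        ← mul_assoc, hss, one_mul]
    · rintro ⟨v, hv, rfl⟩
      refine ⟨fun i => ?_, ?_⟩
      · rw [← mul_assoc, hss, one_mul]; exact Real.exp_pos _
      · have hlog : (fun i => Real.log (s i * Real.exp (v i))) = v := funext fun i => by
          rw [← Real.log_abs, abs_mul, hs, one_mul, abs_of_pos (Real.exp_pos _), Real.log_exp]
        rwa [hlog]
  have hbox : MeasurableSet (Set.Icc lo hi) := measurableSet_Icc
  have hTm : Measurable (T.toLin' : (Fin 3 → ℝ) → Fin 3 → ℝ) :=
    (LinearMap.continuous_of_finiteDimensional _).measurable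
  rw [himg, volume_image_coordinatewise (f' := fun i x => s i * Real.exp x)
    (fun i x => (Real.hasDerivAt_exp x).const_mul _)
    (fun i x y hxy => Real.exp_injective (mul_left_cancel₀ (hs0 i) hxy)) (hTm hbox)]
  have h_int : ∀ v : Fin 3 → ℝ, ENNReal.ofReal |∏ i, s i * Real.exp (v i)| =
      (fun w : Fin 3 → ℝ => ENNReal.ofReal (Real.exp (w 0))) (T.toLin' v) := by
    intro v
    dsimp only
    rw [Finset.abs_prod]
    simp only [abs_mul, hs, one_mul, abs_of_pos (Real.exp_pos _), ← Real.exp_sum]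
    simp [Matrix.mulVec, hT, dotProduct]
  have hg : Measurable (fun w : Fin 3 → ℝ => ENNReal.ofReal (Real.exp (w 0))) := by fun_prop
  simp only [h_int]
  rw [← setLIntegral_map hbox hg hTm, Real.map_matrix_volume_pi_eq_smul_volume_pi hdet,
    Measure.restrict_smul, lintegral_smul_measure]
  have hvol := volume_image_coordinatewise (ι := Fin 3)
    (f := ![Real.exp, id, id]) (f' := ![Real.exp, 1, 1])
    (by intro i x
        fin_cases i
        · exact Real.hasDerivAt_exp x
        · exact hasDerivAt_id x
        · exact hasDerivAt_id x)
    (by intro i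
        fin_cases i
        · exact Real.exp_injective
        · exact Function.injective_id
        · exact Function.injective_id) hbox
  have himg2 : (fun (v : Fin 3 → ℝ) i => (![Real.exp, id, id] : Fin 3 → ℝ → ℝ) i (v i)) ''
      Set.Icc lo hi = Set.Icc ![Real.exp (lo 0), lo 1, lo 2] ![Real.exp (hi 0), hi 1, hi 2] := by
    ext z
    simp only [Set.mem_image, Set.mem_Icc, Pi.le_def, Fin.forall_fin_succ]
    constructor
    · rintro ⟨v, ⟨h1, h2⟩, rfl⟩
      simp at *
      exact ⟨h1, h2⟩
    · rintro ⟨h1, h2⟩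
      simp at h1 h2
      have hz : 0 < z 0 := (Real.exp_pos _).trans_le h1.1
      refine ⟨![Real.log (z 0), z 1, z 2], ?_, ?_⟩
      · simp
        exact ⟨⟨(Real.le_log_iff_exp_le hz).2 h1.1, h1.2⟩,
          ⟨(Real.log_le_iff_le_exp hz).2 h2.1, h2.2⟩⟩
      · funext i
        fin_cases i <;> simp [Real.exp_log hz]
  rw [himg2, Real.volume_Icc_pi] at hvol
  have : ∀ v : Fin 3 → ℝ, |∏ i, (![Real.exp, 1, 1] : Fin 3 → ℝ → ℝ) i (v i)|
      = Real.exp (v 0) := by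
    intro v; simp [Fin.prod_univ_succ]
  simp only [this] at hvol
  rw [← hvol]
  simp only [Fin.prod_univ_succ, Fin.prod_univ_zero]
  have e0 : 0 ≤ Real.exp (hi 0) - Real.exp (lo 0) := sub_nonneg.2 (Real.exp_le_exp.2 (h 0))
  have e1 : 0 ≤ hi 1 - lo 1 := sub_nonneg.2 (h 1)
  simp
  rw [← ENNReal.ofReal_mul e1, ← ENNReal.ofReal_mul e0, ← ENNReal.ofReal_mul (by positivity)]
  congr 1
  ring


/-- The translate by `n` of the half-open fundamental cell spanned by the columns of `M`. -/
def latticeCell {ι : Type*} [Fintype ι] (M : Matrix ι ι ℝ) (n : ι → ℤ) : Set (ι → ℝ) :=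
  M.mulVec '' Set.pi Set.univ fun j => Set.Ico (n j : ℝ) (n j + 1)

section latticeCell

variable {ι : Type*} [Fintype ι] {M : Matrix ι ι ℝ}

theorem abs_sub_le_of_mem_latticeCell {d : ℝ} (hd : ∀ i, ∑ j, |M i j| ≤ d) {n : ι → ℤ}
    {z : ι → ℝ} (hz : z ∈ latticeCell M n) (i : ι) :
    |z i - M.mulVec (fun j => (n j : ℝ)) i| ≤ d := by
  obtain ⟨v, hv, rfl⟩ := hz
  simp only [Set.mem_pi, Set.mem_univ, true_imp_iff] at hv
  refine le_trans ?_ (hd i)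
  rw [Matrix.mulVec, Matrix.mulVec, dotProduct, dotProduct, ← Finset.sum_sub_distrib]
  refine (Finset.abs_sum_le_sum_abs _ _).trans (Finset.sum_le_sum fun j _ => ?_)
  rw [← mul_sub, abs_mul]
  refine mul_le_of_le_one_right (abs_nonneg _) (abs_le.2 ⟨?_, ?_⟩) <;>
    linarith [(hv j).1, (hv j).2]

variable [DecidableEq ι]

theorem volume_latticeCell (M : Matrix ι ι ℝ) (n : ι → ℤ) :
    volume (latticeCell M n) = ENNReal.ofReal |M.det| := by
  have := Measure.addHaar_image_linearMap (volume : Measure (ι → ℝ)) M.toLin'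
    (Set.pi Set.univ fun j => Set.Ico (n j : ℝ) (n j + 1))
  rw [LinearMap.det_toLin', Real.volume_pi_Ico] at this
  exact this.trans (by simp)

theorem mulVec_injective_of_det_ne_zero (hM : M.det ≠ 0) : Function.Injective M.mulVec :=
  Matrix.mulVec_injective_of_isUnit ((Matrix.isUnit_iff_isUnit_det M).2 hM.isUnit)

theorem measurableSet_latticeCell (hM : M.det ≠ 0) (n : ι → ℤ) :
    MeasurableSet (latticeCell M n) := by
  have hinj := mulVec_injective_of_det_ne_zero hM
  refine MeasurableSet.image_of_continuousOn_injOn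
    (MeasurableSet.univ_pi fun _ => measurableSet_Ico) ?_ hinj.injOn
  exact (LinearMap.continuous_of_finiteDimensional M.toLin').continuousOn

theorem disjoint_latticeCell (hM : M.det ≠ 0) {m n : ι → ℤ} (hmn : m ≠ n) :
    Disjoint (latticeCell M m) (latticeCell M n) := by
  refine (Set.disjoint_image_iff (mulVec_injective_of_det_ne_zero hM)).2
    (Set.disjoint_left.2 fun v hv hw => hmn (funext fun j => ?_))
  simp only [Set.mem_pi, Set.mem_univ, true_imp_iff] at hv hw
  rw [← Int.floor_eq_iff.2 (hv j), ← Int.floor_eq_iff.2 (hw j)]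

theorem exists_mem_latticeCell (hM : M.det ≠ 0) (z : ι → ℝ) : ∃ n, z ∈ latticeCell M n := by
  have hu : IsUnit M.det := hM.isUnit
  refine ⟨fun j => ⌊(M⁻¹.mulVec z) j⌋, M⁻¹.mulVec z, ?_, ?_⟩
  · simp only [Set.mem_pi, Set.mem_univ, true_imp_iff]
    exact fun j => ⟨Int.floor_le _, Int.lt_floor_add_one _⟩
  · rw [Matrix.mulVec_mulVec, Matrix.mul_nonsing_inv _ hu, Matrix.one_mulVec]

/-- A set containing the cells around finitely many lattice points has large volume. -/
theorem card_mul_det_le_volume (hM : M.det ≠ 0) {d : ℝ} (hd : ∀ i, ∑ j, |M i j| ≤ d)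
    (Z : Finset (ι → ℤ)) {E : Set (ι → ℝ)}
    (hE : ∀ n ∈ Z, ∀ z, (∀ i, |z i - M.mulVec (fun j => (n j : ℝ)) i| ≤ d) → z ∈ E) :
    (Z.card : ENNReal) * ENNReal.ofReal |M.det| ≤ volume E := by
  calc (Z.card : ENNReal) * ENNReal.ofReal |M.det| = ∑ n ∈ Z, volume (latticeCell M n) := by
        simp [volume_latticeCell]
    _ = volume (⋃ n ∈ Z, latticeCell M n) :=
        (measure_biUnion_finset (fun m _ n _ hmn => disjoint_latticeCell hM hmn)
          fun n _ => measurableSet_latticeCell hM n).symm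
    _ ≤ volume E := measure_mono <| Set.iUnion₂_subset fun n hn z hz =>
        hE n hn z (abs_sub_le_of_mem_latticeCell hd hz)

/-- A set meeting only the cells around finitely many lattice points has small volume. -/
theorem volume_le_card_mul_det (hM : M.det ≠ 0) {d : ℝ} (hd : ∀ i, ∑ j, |M i j| ≤ d)
    (Z : Finset (ι → ℤ)) {E : Set (ι → ℝ)}
    (hE : ∀ z ∈ E, ∀ n : ι → ℤ, (∀ i, |z i - M.mulVec (fun j => (n j : ℝ)) i| ≤ d) → n ∈ Z) :
    volume E ≤ (Z.card : ENNReal) * ENNReal.ofReal |M.det| := by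
  calc volume E ≤ volume (⋃ n ∈ Z, latticeCell M n) := measure_mono fun z hz => by
        obtain ⟨n, hn⟩ := exists_mem_latticeCell hM z
        exact Set.mem_iUnion₂.2 ⟨n, hE z hz n (abs_sub_le_of_mem_latticeCell hd hn), hn⟩
    _ ≤ ∑ n ∈ Z, volume (latticeCell M n) := measure_biUnion_finset_le _ _
    _ = (Z.card : ENNReal) * ENNReal.ofReal |M.det| := by simp [volume_latticeCell]

end latticeCell

/-- If `w` is within `h m / 2` of `z` and `m ≤ s z`, then `w` has the same sign as `z` and its
logarithm is close to that of `z`. -/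
theorem log_close {s z w m h d : ℝ} (hs : |s| = 1) (hm : 0 < m) (hz : m ≤ s * z) (hh : h ≤ 1)
    (hd : d ≤ h / 2 * m) (hzw : |w - z| ≤ d) :
    0 < s * w ∧ |Real.log w - Real.log z| ≤ h := by
  have hlog : ∀ y, Real.log (s * y) = Real.log y := fun y => by
    rw [← Real.log_abs, abs_mul, hs, one_mul, Real.log_abs]
  have h1 : |s * w - s * z| ≤ h / 2 * m := by
    rw [← mul_sub, abs_mul, hs, one_mul]; exact hzw.trans hd
  have h0 : 0 ≤ h := by
    by_contra hneg
    nlinarith [abs_nonneg (s * w - s * z)]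
  obtain ⟨h2, h3⟩ := abs_le.1 h1
  rw [← hlog w, ← hlog z]
  generalize s * w = W at *
  generalize s * z = Z at *
  have hZ : 0 < Z := hm.trans_le hz
  have hb : h / 2 * m ≤ h / 2 * Z := by gcongr
  have hW : 0 < W := by nlinarith
  refine ⟨hW, ?_⟩
  rw [← Real.log_div hW.ne' hZ.ne', abs_le]
  constructor
  · have := Real.one_sub_inv_le_log_of_pos (div_pos hW hZ)
    refine le_trans ?_ this
    rw [inv_div, le_sub_iff_add_le, neg_add_eq_sub, sub_le_iff_le_add, div_le_iff₀ hW]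
    nlinarith
  · refine (Real.log_le_sub_one_of_pos (div_pos hW hZ)).trans ?_
    rw [sub_le_iff_le_add, div_le_iff₀ hZ]
    nlinarith

theorem simplestCubicRoot_spec {a : ℤ} (ha : 7 ≤ a) :
    simplestCubicRoot a ^ 3 - a * simplestCubicRoot a ^ 2 - (a + 3) * simplestCubicRoot a - 1 = 0 ∧
      (a : ℝ) + 1 ≤ simplestCubicRoot a ∧ simplestCubicRoot a ≤ a + 2 := by
  have ha' : (7 : ℝ) ≤ a := by exact_mod_cast ha
  set g : ℝ → ℝ := fun x => x ^ 3 - (a : ℝ) * x ^ 2 - ((a : ℝ) + 3) * x - 1 with hg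
  have hcont : Continuous g := by fun_prop
  obtain ⟨x, hx, hx0⟩ : (0 : ℝ) ∈ g '' Set.Icc ((a : ℝ) + 1) (a + 2) :=
    intermediate_value_Icc (by linarith) hcont.continuousOn
      ⟨by simp only [hg]; nlinarith, by simp only [hg]; nlinarith⟩
  have hub : ∀ y ∈ {x : ℝ | g x = 0}, y ≤ a + 2 := by
    intro y hy
    by_contra! h
    have : 0 < g y := by
      have h1 : 0 < y - a - 2 := by linarith
      have : g y = (y - a - 2) * (y * y + 2 * y + a + 1) + (a + 2) * (a + 1) - 1 := by
        simp only [hg]; ring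
      have hy0 : 0 < y := by linarith
      have h2 : 0 < (y - a - 2) * (y * y + 2 * y + a + 1) := by positivity
      nlinarith
    exact this.ne' hy
  have hne : {x : ℝ | g x = 0}.Nonempty := ⟨x, hx0⟩
  have hbdd : BddAbove {x : ℝ | g x = 0} := ⟨_, hub⟩
  refine ⟨?_, hx.1.trans (le_csSup hbdd hx0), csSup_le hne hub⟩
  exact (isClosed_eq hcont continuous_const).csSup_mem hne hbdd

/-- The roots of `X³ - aX² - (a+3)X - 1`, cyclically permuted by `x ↦ -1/(1+x)`,
starting from the largest one. -/
noncomputable def cubicConj (a : ℤ) : Fin 3 → ℝ :=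
  ![simplestCubicRoot a, simplestCubicRoot a ^ 2 - (a + 1) * simplestCubicRoot a - 2,
    a + 2 + a * simplestCubicRoot a - simplestCubicRoot a ^ 2]

section cubicConj

variable {a : ℤ} (ha : 7 ≤ a)

include ha

theorem cubicConj_rel :
    cubicConj a 1 * (1 + cubicConj a 0) = -1 ∧ cubicConj a 2 * (1 + cubicConj a 1) = -1 ∧
      cubicConj a 0 * (1 + cubicConj a 2) = -1 ∧
      cubicConj a 0 + cubicConj a 1 + cubicConj a 2 = a := by
  obtain ⟨h, h1, -⟩ := simplestCubicRoot_spec ha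
  have ha' : (7 : ℝ) ≤ a := by exact_mod_cast ha
  simp only [cubicConj, Matrix.cons_val_zero, Matrix.cons_val_one,
    Matrix.cons_val]
  generalize simplestCubicRoot a = r at *
  refine ⟨?_, ?_, ?_, ?_⟩
  · linear_combination h
  · grind
  · grind
  · ring

theorem cubicConj_bounds :
    (a : ℝ) + 1 ≤ cubicConj a 0 ∧ cubicConj a 0 ≤ a + 2 ∧
    (-1 ≤ cubicConj a 1 ∧ cubicConj a 1 < 0) ∧ (-2 ≤ cubicConj a 2 ∧ cubicConj a 2 < -1) := by
  obtain ⟨h1, h2, h3, h4⟩ := cubicConj_rel ha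
  obtain ⟨h, h5, h6⟩ := simplestCubicRoot_spec ha
  have ha' : (7 : ℝ) ≤ a := by exact_mod_cast ha
  have e : cubicConj a 0 = simplestCubicRoot a := rfl
  rw [← e] at h5 h6
  generalize cubicConj a 0 = x at *
  generalize cubicConj a 1 = y at *
  generalize cubicConj a 2 = z at *
  refine ⟨h5, h6, ⟨?_, ?_⟩, ?_, ?_⟩ <;> nlinarith

theorem cubicConj_root (i : Fin 3) :
    cubicConj a i ^ 3 - a * cubicConj a i ^ 2 - (a + 3) * cubicConj a i - 1 = 0 := by
  obtain ⟨h1, h2, h3, h4⟩ := cubicConj_rel ha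
  fin_cases i <;> simp only [Fin.zero_eta, Fin.mk_one, Fin.reduceFinMk] <;> grind

end cubicConj

/-- The values of `1, ρ, ρ'` at the three conjugates. -/
noncomputable def conjMatrix (a : ℤ) : Matrix (Fin 3) (Fin 3) ℝ :=
  !![1, cubicConj a 0, cubicConj a 1; 1, cubicConj a 1, cubicConj a 2;
    1, cubicConj a 2, cubicConj a 0]

section conjMatrix

variable {a : ℤ} (ha : 7 ≤ a)

theorem conjMatrix_mulVec (a : ℤ) (v : Fin 3 → ℝ) (i : Fin 3) :
    (conjMatrix a).mulVec v i = v 0 + v 1 * cubicConj a i + v 2 * cubicConj a (i + 1) := by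
  fin_cases i <;> simp [conjMatrix, Matrix.mulVec, dotProduct, Fin.sum_univ_three] <;> ring_nf

include ha

theorem conjMatrix_det : (conjMatrix a).det = -((a : ℝ) ^ 2 + 3 * a + 9) := by
  obtain ⟨h1, h2, h3, h4⟩ := cubicConj_rel ha
  simp only [conjMatrix, Matrix.det_fin_three, Matrix.of_apply, Matrix.cons_val', Matrix.cons_val]
  grind

theorem conjMatrix_row_le (i : Fin 3) : ∑ j, |conjMatrix a i j| ≤ 3 * a := by
  obtain ⟨h1, h2, ⟨h3, h4⟩, h5, h6⟩ := cubicConj_bounds ha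
  have ha' : (7 : ℝ) ≤ a := by exact_mod_cast ha
  have : ∀ j, |cubicConj a j| ≤ a + 2 := by
    intro j
    rw [abs_le]
    fin_cases j <;> simp only [Fin.zero_eta, Fin.mk_one, Fin.reduceFinMk] <;>
      constructor <;> linarith
  rw [Fin.sum_univ_three]
  fin_cases i <;> simp [conjMatrix] <;>
    linarith [this 0, this 1, this 2]

/-- The discriminant of `u + v ρ + w ρ'` is the discriminant of the field times the square of
the index form. -/
theorem prod_sub_eq_indexForm (u v w : ℝ) (y : Fin 3 → ℝ)
    (hy : ∀ i, y i = u + v * cubicConj a i + w * cubicConj a (i + 1)) :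
    (y 0 - y 1) * (y 1 - y 2) * (y 2 - y 0) = ((a : ℝ) ^ 2 + 3 * a + 9) *
      (-v ^ 3 + (a + 3) * v ^ 2 * w - a * v * w ^ 2 - w ^ 3) := by
  obtain ⟨h1, h2, h3, h4⟩ := cubicConj_rel ha
  have e0 := hy 0
  have e1 := hy 1
  have e2 := hy 2
  simp only [show (0 : Fin 3) + 1 = 1 from rfl, show (1 : Fin 3) + 1 = 2 from rfl,
    show (2 : Fin 3) + 1 = 0 from rfl] at e0 e1 e2
  rw [e0, e1, e2]
  generalize cubicConj a 0 = x at *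
  generalize cubicConj a 1 = y at *
  generalize cubicConj a 2 = z at *
  generalize (a : ℝ) = a at *
  have k0 : (x - y) * (y - z) * (z - x) = -(a ^ 2 + 3 * a + 9) := by grind
  have k1 : (x - y) ^ 2 * (y - z) + (y - z) ^ 2 * (z - x) + (z - x) ^ 2 * (x - y) =
    (a + 3) * (a ^ 2 + 3 * a + 9) := by grind
  have k2 : (x - y) * (y - z) ^ 2 + (y - z) * (z - x) ^ 2 + (z - x) * (x - y) ^ 2 =
    -a * (a ^ 2 + 3 * a + 9) := by grind
  linear_combination (v ^ 3 + w ^ 3) * k0 + v ^ 2 * w * k1 + v * w ^ 2 * k2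

end conjMatrix

theorem indexForm_eq_zero (a : ℤ) : ∀ n : ℕ, ∀ v w : ℤ, v.natAbs + w.natAbs ≤ n →
    -v ^ 3 + (a + 3) * v ^ 2 * w - a * v * w ^ 2 - w ^ 3 = 0 → v = 0 ∧ w = 0 := by
  intro n
  induction n using Nat.strong_induction_on with
  | _ n ih =>
    intro v w hn h
    rcases Int.even_or_odd' v with ⟨p, rfl | rfl⟩ <;> rcases Int.even_or_odd' w with ⟨q, rfl | rfl⟩
    · by_cases h0 : p = 0 ∧ q = 0
      · omega
      · have := ih (p.natAbs + q.natAbs) (by omega) p q le_rfl (by linarith)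
        exact absurd this h0
    · exfalso; ring_nf at h; omega
    · exfalso; ring_nf at h; omega
    · exfalso; ring_nf at h; omega

open Polynomial in
/-- The simplest cubic polynomial `X³ - aX² - (a+3)X - 1` over `ℚ`. -/
noncomputable def simplestCubicPoly (a : ℤ) : ℚ[X] :=
  X ^ 3 - C (a : ℚ) * X ^ 2 - C ((a : ℚ) + 3) * X - 1

theorem aeval_simplestCubicPoly {A : Type*} [CommRing A] [Algebra ℚ A] (a : ℤ) (x : A) :
    Polynomial.aeval x (simplestCubicPoly a) = x ^ 3 - a * x ^ 2 - (a + 3) * x - 1 := by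
  simp [simplestCubicPoly, map_ofNat]

theorem simplestCubicPoly_monic (a : ℤ) : (simplestCubicPoly a).Monic := by
  unfold simplestCubicPoly
  monicity!

theorem simplestCubicPoly_natDegree (a : ℤ) : (simplestCubicPoly a).natDegree = 3 := by
  unfold simplestCubicPoly
  compute_degree!

theorem simplestCubicPoly_irreducible (a : ℤ) : Irreducible (simplestCubicPoly a) := by
  have hd := simplestCubicPoly_natDegree a
  rw [Polynomial.irreducible_iff_roots_eq_zero_of_degree_le_three (by omega) (by omega)]
  refine Multiset.eq_zero_of_forall_notMem fun x hx => ?_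
  have hx0 := (Polynomial.mem_roots'.1 hx).2
  rw [Polynomial.IsRoot, ← Polynomial.coe_aeval_eq_eval, aeval_simplestCubicPoly] at hx0
  have hden : (x.den : ℚ) ≠ 0 := by exact_mod_cast x.den_ne_zero
  rw [← Rat.num_div_den x] at hx0
  field_simp at hx0
  have hZ : x.num ^ 3 - a * x.num ^ 2 * x.den - (a + 3) * x.num * x.den ^ 2 - x.den ^ 3 = 0 := by
    have : (x.num ^ 3 - a * x.num ^ 2 * x.den - (a + 3) * x.num * x.den ^ 2 - x.den ^ 3 : ℚ)
      = 0 := by linear_combination hx0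
    exact_mod_cast this
  have := indexForm_eq_zero a _ (-x.den) x.num le_rfl (by linear_combination -hZ)
  exact x.den_ne_zero (by omega)

section field

variable {a : ℤ} (ha : 7 ≤ a) {K : Type} [Field K] [NumberField K] {σ : K →+* ℝ} {ρ : K}
  (hσ : σ ρ = simplestCubicRoot a)

include ha hσ

theorem simplestCubic_generator_root : ρ ^ 3 - a * ρ ^ 2 - (a + 3) * ρ - 1 = 0 := by
  apply σ.injective
  have := (simplestCubicRoot_spec ha).1
  rw [← hσ] at this
  simpa only [map_sub, map_mul, map_pow, map_add, map_intCast, map_ofNat, map_one,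
    map_zero] using this

theorem minpoly_simplestCubic_generator : minpoly ℚ ρ = simplestCubicPoly a :=
  (minpoly.eq_of_irreducible_of_monic (simplestCubicPoly_irreducible a)
    (by rw [aeval_simplestCubicPoly, simplestCubic_generator_root ha hσ])
    (simplestCubicPoly_monic a)).symm

/-- The three real embeddings of a simplest cubic field, whose product is the norm. -/
theorem exists_embeddings (hgen : IntermediateField.adjoin ℚ {ρ} = ⊤) :
    ∃ τ : Fin 3 → K →+* ℝ, (∀ i, τ i ρ = cubicConj a i) ∧
      ∀ x : K, ((Algebra.norm ℚ x : ℚ) : ℝ) = ∏ i, τ i x := by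
  have h_int : IsIntegral ℚ ρ := IsIntegral.of_finite ℚ ρ
  have htop : Algebra.adjoin ℚ {ρ} = ⊤ := by
    rw [← IntermediateField.adjoin_simple_toSubalgebra_of_isAlgebraic h_int.isAlgebraic, hgen,
      IntermediateField.top_toSubalgebra]
  let pb := PowerBasis.ofAdjoinEqTop' h_int htop
  have hpg : pb.gen = ρ := PowerBasis.ofAdjoinEqTop'_gen h_int htop
  have hmin := minpoly_simplestCubic_generator ha hσ
  have hdim : Module.finrank ℚ K = 3 := by
    rw [pb.finrank, PowerBasis.ofAdjoinEqTop'_dim, hmin, simplestCubicPoly_natDegree]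
  have hroot : ∀ i, Polynomial.aeval (cubicConj a i) (minpoly ℚ pb.gen) = 0 := by
    intro i
    rw [hpg, hmin, aeval_simplestCubicPoly, cubicConj_root ha]
  let τ : Fin 3 → K →ₐ[ℚ] ℝ := fun i => pb.lift (cubicConj a i) (hroot i)
  have hτ : ∀ i, τ i ρ = cubicConj a i := fun i => by
    have := pb.lift_gen (cubicConj a i) (hroot i)
    rwa [hpg] at this
  refine ⟨fun i => (τ i).toRingHom, hτ, fun x => ?_⟩
  let φ : Fin 3 → K →ₐ[ℚ] ℂ := fun i => (Complex.ofRealAm.restrictScalars ℚ).comp (τ i)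
  have hφ : ∀ i x, φ i x = (τ i x : ℂ) := fun i x => rfl
  have hinj : Function.Injective φ := by
    intro i j hij
    have h0 : cubicConj a i = cubicConj a j := by
      have := DFunLike.congr_fun hij ρ
      rw [hφ, hφ, hτ, hτ] at this
      exact_mod_cast this
    obtain ⟨h1, h2, ⟨h3, h4⟩, h5, h6⟩ := cubicConj_bounds ha
    have ha' : (7 : ℝ) ≤ a := by exact_mod_cast ha
    fin_cases i <;> fin_cases j <;>
      simp only [Fin.zero_eta, Fin.mk_one, Fin.reduceFinMk] at h0 ⊢ <;> exfalso <;> linarith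
  have hcard : Fintype.card (Fin 3) = Fintype.card (K →ₐ[ℚ] ℂ) := by
    rw [AlgHom.card, hdim, Fintype.card_fin]
  have hbij : Function.Bijective φ := (Fintype.bijective_iff_injective_and_card φ).2 ⟨hinj, hcard⟩
  have hnorm := Algebra.norm_eq_prod_embeddings ℚ ℂ x
  rw [← hbij.prod_comp (fun ψ : K →ₐ[ℚ] ℂ => ψ x)] at hnorm
  simp only [hφ] at hnorm
  rw [← Complex.ofReal_prod] at hnorm
  have : ((Algebra.norm ℚ x : ℚ) : ℂ) = ((∏ i, τ i x : ℝ) : ℂ) := by rw [← hnorm]; simp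
  exact_mod_cast this

/-- The elements of the ring of integers are the integral combinations of `1, ρ, ρ'`. -/
theorem exists_coordinates (hmax : Algebra.adjoin ℤ {ρ} = integralClosure ℤ K)
    {τ : Fin 3 → K →+* ℝ} (hτ : ∀ i, τ i ρ = cubicConj a i) :
    ∃ φ : (Fin 3 → ℤ) → 𝓞 K, Function.Bijective φ ∧
      (∀ n, φ n = 0 ↔ n = 0) ∧
      (∀ n i, τ i (φ n) = (conjMatrix a).mulVec (fun j => (n j : ℝ)) i) := by
  have hroot := simplestCubic_generator_root ha hσ
  have hmem : ∀ x : K, x ∈ Algebra.adjoin ℤ {ρ} ↔ IsIntegral ℤ x := fun x => by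
    rw [hmax]; rfl
  have hρ : IsIntegral ℤ ρ := (hmem ρ).1 (Algebra.subset_adjoin rfl)
  obtain ⟨r, hrρ⟩ : ∃ r : 𝓞 K, (r : K) = ρ := ⟨⟨ρ, hρ⟩, rfl⟩
  have hr : r ^ 3 - a * r ^ 2 - (a + 3) * r - 1 = 0 := by
    apply RingOfIntegers.coe_injective
    simpa only [map_sub, map_mul, map_pow, map_add, map_intCast, map_ofNat, map_one,
      map_zero, hrρ] using hroot
  let r' : 𝓞 K := r ^ 2 - (a + 1) * r - 2
  let φ : (Fin 3 → ℤ) → 𝓞 K := fun n => n 0 + n 1 * r + n 2 * r'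
  have hτr : ∀ i, τ i (r : K) = cubicConj a i := by rwa [hrρ]
  have hτr' : ∀ i, τ i (r' : K) = cubicConj a (i + 1) := by
    intro i
    have e : τ i (r' : K) = cubicConj a i ^ 2 - (a + 1) * cubicConj a i - 2 := by
      simp only [r', map_sub, map_mul, map_add, map_pow, map_intCast, map_one, map_ofNat, hτr]
    rw [e]
    obtain ⟨h1, h2, h3, h4⟩ := cubicConj_rel ha
    fin_cases i <;> simp only [Fin.zero_eta, Fin.mk_one, Fin.reduceFinMk,
      show (0 : Fin 3) + 1 = 1 from rfl, show (1 : Fin 3) + 1 = 2 from rfl,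
      show (2 : Fin 3) + 1 = 0 from rfl] <;> grind
  have hval : ∀ n i, τ i (φ n) = (conjMatrix a).mulVec (fun j => (n j : ℝ)) i := by
    intro n i
    rw [conjMatrix_mulVec]
    simp only [φ, map_add, map_mul, map_intCast, hτr, hτr']
  have hinj : Function.Injective φ := by
    intro m n hmn
    have hdet : (conjMatrix a).det ≠ 0 := by
      rw [conjMatrix_det ha, neg_ne_zero]
      have ha' : (7 : ℝ) ≤ a := by exact_mod_cast ha
      positivity
    have : (fun j => (m j : ℝ)) = fun j => (n j : ℝ) :=
      mulVec_injective_of_det_ne_zero hdet (funext fun i => by rw [← hval, ← hval, hmn])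
    funext j
    exact_mod_cast congrFun this j
  have h0 : φ 0 = 0 := by simp [φ]
  refine ⟨φ, ⟨hinj, fun x => ?_⟩, fun n => ⟨fun h => hinj (h.trans h0.symm), fun h => h ▸ h0⟩,
    hval⟩
  have hx : (x : K) ∈ Algebra.adjoin ℤ {ρ} := (hmem _).2 x.2
  have key : ∀ y ∈ Algebra.adjoin ℤ {ρ}, ∃ n, ((φ n : 𝓞 K) : K) = y := by
    intro y hy
    induction hy using Algebra.adjoin_induction with
    | mem y hy =>
      obtain rfl : y = ρ := hy
      have h1 : φ ![0, 1, 0] = r := by simp [φ]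
      exact ⟨![0, 1, 0], by rw [h1, hrρ]⟩
    | algebraMap n => exact ⟨![n, 0, 0], by simp [φ]⟩
    | add y z _ _ hy hz =>
      obtain ⟨m, rfl⟩ := hy
      obtain ⟨n, rfl⟩ := hz
      exact ⟨m + n, by simp [φ]; ring⟩
    | mul y z _ _ hy hz =>
      obtain ⟨m, rfl⟩ := hy
      obtain ⟨n, rfl⟩ := hz
      refine ⟨![m 0 * n 0 + 2 * m 1 * n 1 - (m 1 * n 2 + m 2 * n 1)
          + m 2 * n 2 * (a + 2),
        m 0 * n 1 + m 1 * n 0 + (a + 1) * m 1 * n 1 - m 2 * n 2,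
        m 0 * n 2 + m 2 * n 0 + m 1 * n 1 - (m 1 * n 2 + m 2 * n 1) + a * m 2 * n 2], ?_⟩
      rw [← map_mul]
      congr 1
      have e1 : r * r = r' + (a + 1) * r + 2 := by simp only [r']; ring
      have e2 : r * r' = -1 - r' := by simp only [r']; linear_combination hr
      have e3 : r' * r' = a * r' - r + (a + 2) := by
        simp only [r']
        linear_combination (r - a - 2) * hr
      simp only [φ, Matrix.cons_val_zero, Matrix.cons_val_one, Matrix.cons_val]
      push_cast
      linear_combination (-m 1 * n 1 : 𝓞 K) * e1 - (m 1 * n 2 + m 2 * n 1 : 𝓞 K) * e2 -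
        (m 2 * n 2 : 𝓞 K) * e3
  obtain ⟨n, hn⟩ := key _ hx
  exact ⟨n, RingOfIntegers.coe_injective hn⟩

end field

/-- The logarithms of the absolute values of the conjugates of the fundamental unit. -/
noncomputable def unitLog (a : ℤ) (i : Fin 3) : ℝ := Real.log (cubicConj a i)

theorem unitLog_spec {a : ℤ} (ha : 7 ≤ a) :
    unitLog a 1 = -(unitLog a 0 + unitLog a 2) ∧ 2 ≤ unitLog a 0 ∧ 0 < unitLog a 2 ∧
      unitLog a 2 ≤ 1 ∧ unitLog a 0 + unitLog a 2 ≤ Real.log (a + 3) := by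
  obtain ⟨h1, h2, h3, h4⟩ := cubicConj_rel ha
  obtain ⟨k1, k2, ⟨k3, k4⟩, k5, k6⟩ := cubicConj_bounds ha
  have ha' : (7 : ℝ) ≤ a := by exact_mod_cast ha
  have e1 : unitLog a 1 = -Real.log (1 + cubicConj a 0) := by
    rw [unitLog, ← Real.log_inv, ← Real.log_neg_eq_log]
    congr 1
    exact eq_inv_of_mul_eq_one_left (by linarith)
  have hprod : cubicConj a 0 * cubicConj a 1 * cubicConj a 2 = 1 := by grind
  have e2 : unitLog a 0 + unitLog a 1 + unitLog a 2 = 0 := by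
    rw [unitLog, unitLog, unitLog, ← Real.log_mul (by linarith) k4.ne,
      ← Real.log_mul (mul_ne_zero (by linarith) k4.ne) (by linarith), hprod, Real.log_one]
  have e3 : unitLog a 2 = Real.log (-cubicConj a 2) := by rw [Real.log_neg_eq_log, unitLog]
  refine ⟨by linarith, ?_, ?_, ?_, ?_⟩
  · rw [unitLog, Real.le_log_iff_exp_le (by linarith)]
    have := Real.exp_one_lt_d9
    rw [show (2 : ℝ) = 1 + 1 by norm_num, Real.exp_add]
    nlinarith [Real.exp_pos 1]
  · rw [e3]
    exact Real.log_pos (by linarith)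
  · rw [e3]
    have := Real.log_le_sub_one_of_pos (x := -cubicConj a 2) (by linarith)
    linarith
  · rw [show unitLog a 0 + unitLog a 2 = Real.log (1 + cubicConj a 0) by linarith]
    exact Real.log_le_log (by linarith) (by linarith)

/-- The quadratic form value which is the regulator of the units generated by two conjugates. -/
noncomputable def unitReg (a : ℤ) : ℝ :=
  unitLog a 0 ^ 2 + unitLog a 0 * unitLog a 2 + unitLog a 2 ^ 2

/-- The rows are, up to scaling, the basis dual to the norm direction and the two unit vectors. -/
noncomputable def unitMatrix (a : ℤ) : Matrix (Fin 3) (Fin 3) ℝ :=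
  !![1, 1, 1;
    unitLog a 0 - unitLog a 2, -(2 * unitLog a 0 + unitLog a 2), unitLog a 0 + 2 * unitLog a 2;
    -(unitLog a 0 + 2 * unitLog a 2), -(unitLog a 0 - unitLog a 2),
      2 * unitLog a 0 + unitLog a 2]

theorem mulVec_fin_three (M : Matrix (Fin 3) (Fin 3) ℝ) (v : Fin 3 → ℝ) (i : Fin 3) :
    M.mulVec v i = M i 0 * v 0 + M i 1 * v 1 + M i 2 * v 2 := by
  rw [Matrix.mulVec, dotProduct, Fin.sum_univ_three]

theorem unitMatrix_mulVec (a : ℤ) (v : Fin 3 → ℝ) :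
    (unitMatrix a).mulVec v 0 = v 0 + v 1 + v 2 ∧
    (unitMatrix a).mulVec v 1 = (unitLog a 0 - unitLog a 2) * v 0 -
      (2 * unitLog a 0 + unitLog a 2) * v 1 + (unitLog a 0 + 2 * unitLog a 2) * v 2 ∧
    (unitMatrix a).mulVec v 2 = -(unitLog a 0 + 2 * unitLog a 2) * v 0 -
      (unitLog a 0 - unitLog a 2) * v 1 + (2 * unitLog a 0 + unitLog a 2) * v 2 := by
  refine ⟨?_, ?_, ?_⟩ <;> rw [mulVec_fin_three] <;> simp [unitMatrix] <;> ring

theorem abs_unitMatrix_det {a : ℤ} : |(unitMatrix a).det| = 9 * unitReg a := by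
  have : (unitMatrix a).det = -(9 * unitReg a) := by
    rw [Matrix.det_fin_three]
    simp [unitMatrix, unitReg]
    ring
  rw [this, abs_neg, abs_of_nonneg]
  unfold unitReg
  nlinarith [sq_nonneg (unitLog a 0 + unitLog a 2), sq_nonneg (unitLog a 0),
    sq_nonneg (unitLog a 2)]

theorem unitReg_bounds {a : ℤ} (ha : 7 ≤ a) :
    unitLog a 0 ^ 2 ≤ unitReg a ∧ unitReg a ≤ Real.log (a + 3) ^ 2 := by
  obtain ⟨-, h1, h2, -, h3⟩ := unitLog_spec ha
  unfold unitReg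
  constructor <;> nlinarith

/-- Recovering the logarithms from the dual coordinates. -/
theorem unitReg_mul_coord {a : ℤ} (ha : 7 ≤ a) (v : Fin 3 → ℝ) (i : Fin 3) :
    3 * unitReg a * v i = unitReg a * (unitMatrix a).mulVec v 0 +
      (unitMatrix a).mulVec v 1 * unitLog a i + (unitMatrix a).mulVec v 2 * unitLog a (i + 1) := by
  obtain ⟨h1, -⟩ := unitLog_spec ha
  obtain ⟨e0, e1, e2⟩ := unitMatrix_mulVec a v
  rw [e0, e1, e2, unitReg]
  fin_cases i <;> simp only [Fin.zero_eta, Fin.mk_one, Fin.reduceFinMk,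
      show (0 : Fin 3) + 1 = 1 from rfl, show (1 : Fin 3) + 1 = 2 from rfl,
      show (2 : Fin 3) + 1 = 0 from rfl, h1] <;> ring

theorem unitMatrix_mulVec_add_units {a : ℤ} (ha : 7 ≤ a) (v : Fin 3 → ℝ) (j k : ℝ) :
    (unitMatrix a).mulVec (fun i => v i + j * unitLog a i + k * unitLog a (i + 1)) 1 =
      (unitMatrix a).mulVec v 1 + j * (3 * unitReg a) ∧
    (unitMatrix a).mulVec (fun i => v i + j * unitLog a i + k * unitLog a (i + 1)) 2 =
      (unitMatrix a).mulVec v 2 + k * (3 * unitReg a) := by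
  obtain ⟨h1, -⟩ := unitLog_spec ha
  obtain ⟨-, e1, e2⟩ := unitMatrix_mulVec a v
  obtain ⟨-, f1, f2⟩ :=
    unitMatrix_mulVec a (fun i => v i + j * unitLog a i + k * unitLog a (i + 1))
  rw [e1, e2, f1, f2, unitReg]
  simp only [show (0 : Fin 3) + 1 = 1 from rfl, show (1 : Fin 3) + 1 = 2 from rfl,
      show (2 : Fin 3) + 1 = 0 from rfl, h1]
  constructor <;> ring

/-- The point of `ℝ³` formed by the conjugates of the integer with coordinates `n`. -/
noncomputable def conjVec (a : ℤ) (n : Fin 3 → ℤ) : Fin 3 → ℝ :=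
  (conjMatrix a).mulVec fun j => (n j : ℝ)

/-- The logarithms of the absolute values of the conjugates. -/
noncomputable def logVec (a : ℤ) (n : Fin 3 → ℤ) : Fin 3 → ℝ := fun i => Real.log (conjVec a n i)

theorem abs_conjMatrix_det {a : ℤ} (ha : 7 ≤ a) :
    |(conjMatrix a).det| = (a : ℝ) ^ 2 + 3 * a + 9 := by
  have ha' : (7 : ℝ) ≤ a := by exact_mod_cast ha
  rw [conjMatrix_det ha, abs_neg, abs_of_pos (by positivity)]

theorem conjMatrix_det_ne_zero {a : ℤ} (ha : 7 ≤ a) : (conjMatrix a).det ≠ 0 := by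
  have ha' : (7 : ℝ) ≤ a := by exact_mod_cast ha
  rw [← abs_pos, abs_conjMatrix_det ha]
  positivity

theorem card_mul_disc_le {a : ℤ} (ha : 7 ≤ a) {Z : Finset (Fin 3 → ℤ)} {E : Set (Fin 3 → ℝ)}
    {V : ℝ} (hV : 0 ≤ V) (hEV : volume E ≤ ENNReal.ofReal V)
    (hE : ∀ n ∈ Z, ∀ z, (∀ i, |z i - conjVec a n i| ≤ 3 * a) → z ∈ E) :
    (Z.card : ℝ) * ((a : ℝ) ^ 2 + 3 * a + 9) ≤ V := by
  have h := (card_mul_det_le_volume (conjMatrix_det_ne_zero ha) (conjMatrix_row_le ha) Z hE).trans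
    hEV
  rw [abs_conjMatrix_det ha, ← ENNReal.ofReal_natCast, ← ENNReal.ofReal_mul (by positivity)] at h
  exact (ENNReal.ofReal_le_ofReal_iff hV).1 h

theorem le_card_mul_disc {a : ℤ} (ha : 7 ≤ a) {Z : Finset (Fin 3 → ℤ)} {E : Set (Fin 3 → ℝ)}
    {V : ℝ} (hEV : ENNReal.ofReal V ≤ volume E)
    (hE : ∀ z ∈ E, ∀ n, (∀ i, |z i - conjVec a n i| ≤ 3 * a) → n ∈ Z) :
    V ≤ (Z.card : ℝ) * ((a : ℝ) ^ 2 + 3 * a + 9) := by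
  have h := hEV.trans
    (volume_le_card_mul_det (conjMatrix_det_ne_zero ha) (conjMatrix_row_le ha) Z hE)
  have ha' : (7 : ℝ) ≤ a := by exact_mod_cast ha
  rw [abs_conjMatrix_det ha, ← ENNReal.ofReal_natCast, ← ENNReal.ofReal_mul (by positivity)] at h
  exact (ENNReal.ofReal_le_ofReal_iff (by positivity)).1 h

theorem le_mul_of_log_le {s z m : ℝ} (hs : |s| = 1) (hz : 0 < s * z) (hm : 0 < m)
    (h : Real.log m ≤ Real.log z) : m ≤ s * z := by
  have : Real.log z = Real.log (s * z) := by
    rw [← Real.log_abs (s * z), abs_mul, hs, one_mul, Real.log_abs]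
  rw [this] at h
  exact (Real.log_le_log_iff hm hz).1 h

theorem abs_mulVec_sub_le {M : Matrix (Fin 3) (Fin 3) ℝ} {v w : Fin 3 → ℝ} {h : ℝ}
    (hvw : ∀ i, |w i - v i| ≤ h) (i : Fin 3) :
    |M.mulVec w i - M.mulVec v i| ≤ (|M i 0| + |M i 1| + |M i 2|) * h := by
  rw [mulVec_fin_three, mulVec_fin_three]
  have e : M i 0 * w 0 + M i 1 * w 1 + M i 2 * w 2 - (M i 0 * v 0 + M i 1 * v 1 + M i 2 * v 2) =
    M i 0 * (w 0 - v 0) + M i 1 * (w 1 - v 1) + M i 2 * (w 2 - v 2) := by ring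
  rw [e]
  refine (abs_add_three _ _ _).trans ?_
  rw [abs_mul, abs_mul, abs_mul, add_mul, add_mul]
  gcongr <;> apply hvw

theorem mem_Icc_of_abs_sub_le {x y h l u : ℝ} (hxy : |x - y| ≤ h) (hy : y ∈ Set.Icc l u) :
    x ∈ Set.Icc (l - h) (u + h) := by
  have := abs_le.1 hxy
  exact ⟨by linarith [hy.1], by linarith [hy.2]⟩

theorem exp_three_mul_le : Real.exp (3 * (1 / 10 ^ 6)) ≤ 1 + 1 / 10 ^ 5 := by
  have h := Real.one_sub_le_exp_neg (3 * (1 / 10 ^ 6))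
  rw [Real.exp_neg] at h
  have h2 := Real.exp_pos (3 * (1 / 10 ^ 6))
  have h3 : (1 - 3 * (1 / 10 ^ 6)) * Real.exp (3 * (1 / 10 ^ 6)) ≤ 1 := by
    calc _ ≤ (Real.exp (3 * (1 / 10 ^ 6)))⁻¹ * Real.exp (3 * (1 / 10 ^ 6)) := by gcongr
      _ = 1 := inv_mul_cancel₀ h2.ne'
  nlinarith

theorem card_shell_le {a : ℤ} (ha : 7 ≤ a) {B : ℝ} (hB : 10 ^ 12 * (a : ℝ) ^ 2 ≤ B)
    {s : Fin 3 → ℝ} (hs : ∀ i, |s i| = 1) (Z : Finset (Fin 3 → ℤ))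
    (hpos : ∀ n ∈ Z, ∀ i, 0 < s i * conjVec a n i)
    (h0 : ∀ n ∈ Z, (unitMatrix a).mulVec (logVec a n) 0 ∈
      Set.Icc (3 * Real.log (B / 1000)) (3 * Real.log B))
    (h1 : ∀ n ∈ Z, (unitMatrix a).mulVec (logVec a n) 1 ∈ Set.Icc 0 (3 * unitReg a))
    (h2 : ∀ n ∈ Z, (unitMatrix a).mulVec (logVec a n) 2 ∈ Set.Icc 0 (3 * unitReg a)) :
    (Z.card : ℝ) * ((a : ℝ) ^ 2 + 3 * a + 9) ≤ 1.001 * unitReg a * B ^ 3 := by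
  obtain ⟨hL1, hA, hb, hb1, hAb⟩ := unitLog_spec ha
  have hR := (unitReg_bounds ha).1
  have ha' : (7 : ℝ) ≤ a := by exact_mod_cast ha
  set A := unitLog a 0 with hAdef
  set b := unitLog a 2 with hbdef
  set R := unitReg a with hRdef
  have hRpos : 0 < R := by nlinarith
  have hBpos : 0 < B := by nlinarith
  set h : ℝ := 1 / 10 ^ 6 with hh
  set T := unitMatrix a with hT
  let lo : Fin 3 → ℝ := ![3 * Real.log (B / 1000) - 3 * h, -(6 * A * h), -(6 * A * h)]
  let hi : Fin 3 → ℝ := ![3 * Real.log B + 3 * h, 3 * R + 6 * A * h, 3 * R + 6 * A * h]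
  have hhpos : 0 < h := by norm_num [hh]
  have hAh : 0 < A * h := by positivity
  have hlog : Real.log (B / 1000) ≤ Real.log B :=
    Real.log_le_log (by positivity) (by linarith)
  have hlohi : lo ≤ hi := by
    intro i
    fin_cases i <;> simp [lo, hi] <;> linarith
  have hT0 : T 0 = fun _ => 1 := by
    funext j
    fin_cases j <;> simp [hT, unitMatrix]
  have hdet : |T.det| = 9 * R := abs_unitMatrix_det
  have hdet0 : T.det ≠ 0 := by rw [← abs_pos, hdet]; positivity
  have hvol := volume_logBox hs hT0 hdet0 hlohi
  refine card_mul_disc_le ha (E := logBox s T lo hi) (by positivity) ?_ ?_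
  · rw [hvol, hdet]
    apply ENNReal.ofReal_le_ofReal
    have e1 : Real.exp (hi 0) - Real.exp (lo 0) ≤ (1 + 1 / 10 ^ 5) * B ^ 3 := by
      have : Real.exp (hi 0) = B ^ 3 * Real.exp (3 * h) := by
        simp only [hi, Matrix.cons_val_zero]
        rw [Real.exp_add, show 3 * Real.log B = Real.log (B ^ 3) by rw [Real.log_pow]; norm_num,
          Real.exp_log (by positivity)]
      have h3 := exp_three_mul_le
      have h4 : 0 < B ^ 3 := by positivity
      rw [this]
      nlinarith [Real.exp_pos (lo 0)]
    have e2 : hi 1 - lo 1 ≤ 3 * R * (1 + 4 * h) := by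
      simp only [hi, lo, Matrix.cons_val_one, Matrix.cons_val_zero]
      nlinarith
    have e2' : 0 ≤ hi 1 - lo 1 := by linarith [hlohi 1]
    have e3 : hi 2 - lo 2 = hi 1 - lo 1 := by simp [hi, lo]
    rw [e3, div_le_iff₀ (by positivity)]
    calc _ ≤ ((1 + 1 / 10 ^ 5) * B ^ 3) * (3 * R * (1 + 4 * h)) * (3 * R * (1 + 4 * h)) := by
          gcongr
      _ = ((1 + 1 / 10 ^ 5) * (1 + 4 * h) ^ 2) * (B ^ 3 * R * (9 * R)) := by ring
      _ ≤ 1.001 * (B ^ 3 * R * (9 * R)) := by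
          gcongr
          norm_num [hh]
      _ = _ := by ring
  · intro n hn z hz
    have hm : ∀ i, B / 1000 / (a + 3) ≤ s i * conjVec a n i := by
      intro i
      refine le_mul_of_log_le (hs i) (hpos n hn i) (by positivity) ?_
      rw [Real.log_div (by positivity) (by positivity)]
      have key := unitReg_mul_coord ha (logVec a n) i
      obtain ⟨q0, q0'⟩ := h0 n hn
      obtain ⟨q1, q1'⟩ := h1 n hn
      obtain ⟨q2, q2'⟩ := h2 n hn
      rw [← hT, ← hRdef] at key
      set r := T.mulVec (logVec a n) 0
      set p := T.mulVec (logVec a n) 1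
      set q := T.mulVec (logVec a n) 2
      have hpq : -(3 * R * (A + b)) ≤ p * unitLog a i + q * unitLog a (i + 1) := by
        fin_cases i <;> simp only [Fin.zero_eta, Fin.mk_one, Fin.reduceFinMk,
          show (0 : Fin 3) + 1 = 1 from rfl, show (1 : Fin 3) + 1 = 2 from rfl,
          show (2 : Fin 3) + 1 = 0 from rfl, hL1, ← hAdef, ← hbdef] <;> nlinarith
      have : 3 * R * (Real.log (B / 1000) - Real.log (a + 3)) ≤ 3 * R * logVec a n i := by
        rw [key]; nlinarith
      exact le_of_mul_le_mul_left this (by positivity)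
    have hd : 3 * (a : ℝ) ≤ h / 2 * (B / 1000 / (a + 3)) := by
      rw [hh, div_div, mul_div_assoc', le_div_iff₀ (by positivity)]
      nlinarith
    have hc : ∀ i, 0 < s i * z i ∧ |Real.log (z i) - Real.log (conjVec a n i)| ≤ h := fun i =>
      log_close (hs i) (by positivity) (hm i) (by norm_num [hh]) hd (hz i)
    have hcl : ∀ i, |T.mulVec (fun i => Real.log (z i)) i - T.mulVec (logVec a n) i| ≤
        (|T i 0| + |T i 1| + |T i 2|) * h := fun i => abs_mulVec_sub_le (fun i => (hc i).2) i
    refine ⟨fun i => (hc i).1, ?_⟩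
    have r0 : |T 0 0| + |T 0 1| + |T 0 2| = 3 := by norm_num [hT0]
    have r1 : |T 1 0| + |T 1 1| + |T 1 2| ≤ 6 * A := by
      simp only [hT, unitMatrix, Matrix.cons_val, ← hAdef, ← hbdef, Matrix.of_apply]
      rw [abs_neg, abs_of_nonneg, abs_of_nonneg, abs_of_nonneg] <;> linarith
    have r2 : |T 2 0| + |T 2 1| + |T 2 2| ≤ 6 * A := by
      simp only [hT, unitMatrix, Matrix.cons_val, ← hAdef, ← hbdef, Matrix.of_apply]
      rw [abs_neg, abs_neg, abs_of_nonneg, abs_of_nonneg, abs_of_nonneg] <;> linarith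
    have c0 := mem_Icc_of_abs_sub_le ((hcl 0).trans_eq (by rw [r0])) (h0 n hn)
    have c1 := mem_Icc_of_abs_sub_le
      ((hcl 1).trans (mul_le_mul_of_nonneg_right r1 hhpos.le)) (h1 n hn)
    have c2 := mem_Icc_of_abs_sub_le
      ((hcl 2).trans (mul_le_mul_of_nonneg_right r2 hhpos.le)) (h2 n hn)
    rw [zero_sub] at c1 c2
    constructor <;> intro i <;> fin_cases i
    exacts [c0.1, c1.1, c2.1, c0.2, c1.2, c2.2]

theorem card_box_le {a : ℤ} (ha : 7 ≤ a) {w : Fin 3 → ℝ} (hw : ∀ i, 3 * (a : ℝ) ≤ w i)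
    (Z : Finset (Fin 3 → ℤ)) (hZ : ∀ n ∈ Z, ∀ i, |conjVec a n i| ≤ w i) :
    (Z.card : ℝ) * ((a : ℝ) ^ 2 + 3 * a + 9) ≤ 64 * ∏ i, w i := by
  have ha' : (7 : ℝ) ≤ a := by exact_mod_cast ha
  have hw0 : ∀ i, 0 < w i := fun i => by linarith [hw i]
  have hpos : 0 < ∏ i, w i := Finset.prod_pos fun i _ => hw0 i
  refine card_mul_disc_le ha (E := Set.Icc (fun i => -(2 * w i)) fun i => 2 * w i)
    (by positivity) ?_ ?_
  · rw [Real.volume_Icc_pi, ← ENNReal.ofReal_prod_of_nonneg fun i _ => by linarith [hw0 i]]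
    apply ENNReal.ofReal_le_ofReal
    rw [Fin.prod_univ_three, Fin.prod_univ_three]
    exact le_of_eq (by ring)
  · intro n hn z hz
    constructor <;> intro i <;> have h1 := abs_le.1 (hz i) <;>
      have h2 := abs_le.1 (hZ n hn i) <;> have h3 := hw i <;> dsimp only <;> linarith [h1.1, h1.2]

theorem exp_nine_le : Real.exp 9 ≤ 8200 := by
  have h := Real.exp_one_lt_d9
  calc Real.exp 9 = Real.exp 1 ^ 9 := by rw [← Real.exp_nat_mul]; norm_num
    _ ≤ 2.7182818286 ^ 9 := by gcongr
    _ ≤ 8200 := by norm_num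

theorem floor_sub_bounds {t N : ℝ} (hN : 0 < N) (ht : 0 ≤ t) {j : ℕ} (hj : ⌊N * t⌋₊ = j) :
    0 ≤ t - j / N ∧ (t - j / N) * N ≤ 1 := by
  have h1 := Nat.floor_le (mul_nonneg hN.le ht)
  have h2 := Nat.lt_floor_add_one (N * t)
  rw [hj] at h1 h2
  have e : (t - j / N) * N = N * t - j := by field_simp
  refine ⟨?_, by linarith⟩
  rw [sub_nonneg, div_le_iff₀ hN]
  linarith

theorem card_small_le {a : ℤ} (ha : 7 ≤ a) {B : ℝ} (hB : 10 ^ 12 * (a : ℝ) ^ 2 ≤ B)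
    (Z : Finset (Fin 3 → ℤ)) (hne : ∀ n ∈ Z, ∀ i, conjVec a n i ≠ 0)
    (h0 : ∀ n ∈ Z, (unitMatrix a).mulVec (logVec a n) 0 ≤ 3 * Real.log (B / 1000))
    (h1 : ∀ n ∈ Z, (unitMatrix a).mulVec (logVec a n) 1 ∈ Set.Ico 0 (3 * unitReg a))
    (h2 : ∀ n ∈ Z, (unitMatrix a).mulVec (logVec a n) 2 ∈ Set.Ico 0 (3 * unitReg a)) :
    (Z.card : ℝ) * ((a : ℝ) ^ 2 + 3 * a + 9) ≤ 0.01 * unitReg a * B ^ 3 := by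
  obtain ⟨hL1, hA, hb, hb1, hAb⟩ := unitLog_spec ha
  have hR := (unitReg_bounds ha).1
  have ha' : (7 : ℝ) ≤ a := by exact_mod_cast ha
  set A := unitLog a 0 with hAdef
  set b := unitLog a 2 with hbdef
  set R := unitReg a with hRdef
  have hRpos : 0 < R := by nlinarith
  have hBpos : 0 < B := by nlinarith
  set T := unitMatrix a with hT
  set N := ⌈A⌉₊ with hN
  have hAN : A ≤ N := Nat.le_ceil A
  have hN2 : (N : ℝ) < A + 1 := Nat.ceil_lt_add_one (by linarith)
  have hNpos : (0 : ℝ) < N := by linarith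
  let f : (Fin 3 → ℤ) → ℕ × ℕ := fun n =>
    (⌊(N : ℝ) * (T.mulVec (logVec a n) 1 / (3 * R))⌋₊,
      ⌊(N : ℝ) * (T.mulVec (logVec a n) 2 / (3 * R))⌋₊)
  have hlt : ∀ t ∈ Set.Ico 0 (3 * R), ⌊(N : ℝ) * (t / (3 * R))⌋₊ < N := by
    intro t ht
    rw [Nat.floor_lt (mul_nonneg hNpos.le (div_nonneg ht.1 (by positivity)))]
    have : t / (3 * R) < 1 := (div_lt_one (by positivity)).2 ht.2
    nlinarith
  have hf : ∀ n ∈ Z, f n ∈ Finset.range N ×ˢ Finset.range N := by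
    intro n hn
    rw [Finset.mem_product, Finset.mem_range, Finset.mem_range]
    exact ⟨hlt _ (h1 n hn), hlt _ (h2 n hn)⟩
  have hfib : ∀ y ∈ Finset.range N ×ˢ Finset.range N,
      ((Z.filter fun n => f n = y).card : ℝ) * ((a : ℝ) ^ 2 + 3 * a + 9) ≤
        0.001 * B ^ 3 := by
    rintro ⟨j, k⟩ hy
    rw [Finset.mem_product, Finset.mem_range, Finset.mem_range] at hy
    have hj : (j : ℝ) / N ≤ 1 := (div_le_one hNpos).2 (by exact_mod_cast hy.1.le)
    have hk : (k : ℝ) / N ≤ 1 := (div_le_one hNpos).2 (by exact_mod_cast hy.2.le)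
    have hj0 : 0 ≤ (j : ℝ) / N := by positivity
    have hk0 : 0 ≤ (k : ℝ) / N := by positivity
    let w : Fin 3 → ℝ := fun i =>
      B / 1000 * Real.exp (3 + (j / N * unitLog a i + k / N * unitLog a (i + 1)))
    have hw : ∀ i, 3 * (a : ℝ) ≤ w i := by
      intro i
      have e : -Real.log (a + 3) ≤ 3 + (j / N * unitLog a i + k / N * unitLog a (i + 1)) := by
        fin_cases i <;> simp only [Fin.zero_eta, Fin.mk_one, Fin.reduceFinMk,
          show (0 : Fin 3) + 1 = 1 from rfl, show (1 : Fin 3) + 1 = 2 from rfl,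
          show (2 : Fin 3) + 1 = 0 from rfl, hL1, ← hAdef, ← hbdef] <;> nlinarith
      calc 3 * (a : ℝ) ≤ B / 1000 * ((a : ℝ) + 3)⁻¹ := by
            rw [← div_eq_mul_inv, le_div_iff₀ (by positivity)]
            nlinarith
        _ = B / 1000 * Real.exp (-Real.log (a + 3)) := by
            rw [Real.exp_neg, Real.exp_log (by positivity)]
        _ ≤ w i := by
            dsimp only [w]
            gcongr
    have hprod : ∏ i, w i = Real.exp 9 * (B / 1000) ^ 3 := by
      rw [Fin.prod_univ_three]
      simp only [w, show (0 : Fin 3) + 1 = 1 from rfl, show (1 : Fin 3) + 1 = 2 from rfl,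
          show (2 : Fin 3) + 1 = 0 from rfl, hL1, ← hAdef, ← hbdef]
      rw [show (9 : ℝ) = (3 + (j / N * A + k / N * -(A + b))) +
        (3 + (j / N * -(A + b) + k / N * b)) + (3 + (j / N * b + k / N * A)) by ring,
        Real.exp_add (_ + _), Real.exp_add (3 + (j / N * A + k / N * -(A + b)))]
      ring
    refine (card_box_le ha hw _ fun n hn i => ?_).trans ?_
    · obtain ⟨hnZ, hfn⟩ := Finset.mem_filter.1 hn
      obtain ⟨hf1, hf2⟩ := Prod.ext_iff.1 hfn
      obtain ⟨p1, p2⟩ := floor_sub_bounds hNpos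
        (div_nonneg (h1 n hnZ).1 (by positivity : 0 ≤ 3 * R)) hf1
      obtain ⟨q1, q2⟩ := floor_sub_bounds hNpos
        (div_nonneg (h2 n hnZ).1 (by positivity : 0 ≤ 3 * R)) hf2
      have key := unitReg_mul_coord ha (logVec a n) i
      have hr := h0 n hnZ
      rw [← hT, ← hRdef] at key
      rw [← Real.log_le_log_iff (abs_pos.2 (hne n hnZ i)) (by positivity), Real.log_abs,
        Real.log_mul (by positivity) (by positivity), Real.log_exp]
      change logVec a n i ≤ _
      generalize T.mulVec (logVec a n) 0 = r at key hr
      generalize T.mulVec (logVec a n) 1 = p at key p1 p2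
      generalize T.mulVec (logVec a n) 2 = q at key q1 q2
      have hv : logVec a n i = r / 3 + (p / (3 * R) * unitLog a i +
          q / (3 * R) * unitLog a (i + 1)) := by
        field_simp
        linarith
      dsimp only at p1 p2 q1 q2
      generalize p / (3 * R) = p' at hv p1 p2
      generalize q / (3 * R) = q' at hv q1 q2
      have hpq : (p' - j / N) * unitLog a i + (q' - k / N) * unitLog a (i + 1) ≤ 3 := by
        generalize p' - (j : ℝ) / N = t at p1 p2 ⊢
        generalize q' - (k : ℝ) / N = u at q1 q2 ⊢
        fin_cases i <;> simp only [Fin.zero_eta, Fin.mk_one, Fin.reduceFinMk,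
          show (0 : Fin 3) + 1 = 1 from rfl, show (1 : Fin 3) + 1 = 2 from rfl,
          show (2 : Fin 3) + 1 = 0 from rfl, hL1, ← hAdef, ← hbdef] <;> nlinarith
      rw [hv]
      linarith
    · rw [hprod]
      have := exp_nine_le
      have h3 : 0 < B ^ 3 := by positivity
      nlinarith
  rw [Finset.card_eq_sum_card_fiberwise hf, Nat.cast_sum, Finset.sum_mul]
  refine (Finset.sum_le_card_nsmul _ _ _ hfib).trans ?_
  rw [Finset.card_product, Finset.card_range, nsmul_eq_mul, Nat.cast_mul]
  have h3 : 0 < B ^ 3 := by positivity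
  have h4 : (N : ℝ) * N ≤ 10 * R := by nlinarith
  nlinarith

/-- The four sign patterns with positive first coordinate. -/
noncomputable def signVec (y : Bool × Bool) : Fin 3 → ℝ := ![1, bif y.1 then 1 else -1, bif y.2 then 1 else -1]

theorem abs_signVec (y : Bool × Bool) (i : Fin 3) : |signVec y i| = 1 := by
  obtain ⟨y1, y2⟩ := y
  cases y1 <;> cases y2 <;> fin_cases i <;> simp [signVec]

theorem card_eq_sum_signVec {a : ℤ} {Z : Finset (Fin 3 → ℤ)}
    (hne : ∀ n ∈ Z, ∀ i, conjVec a n i ≠ 0) (hpos : ∀ n ∈ Z, 0 < conjVec a n 0) :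
    Z.card = ∑ y, (Z.filter fun n => ∀ i, 0 < signVec y i * conjVec a n i).card := by
  rw [Finset.card_eq_sum_card_fiberwise (t := Finset.univ)
    (f := fun n => (decide (0 < conjVec a n 1), decide (0 < conjVec a n 2)))
    fun n _ => Finset.mem_univ _]
  refine Finset.sum_congr rfl fun y _ => congrArg _ (Finset.filter_congr fun n hn => ?_)
  have h0 := hpos n hn
  have h1 := hne n hn 1
  have h2 := hne n hn 2
  obtain ⟨y1, y2⟩ := y
  rw [Fin.forall_fin_succ, Fin.forall_fin_two]
  cases y1 <;> cases y2 <;> simp [signVec, h0] <;>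
    simp only [le_iff_lt_or_eq, h1, h2, or_false, implies_true]

theorem log_add_three_le {a : ℤ} (ha : 7 ≤ a) : Real.log (a + 3) ≤ 1.2 * Real.log a := by
  have ha' : (7 : ℝ) ≤ a := by exact_mod_cast ha
  have h : Real.log (((a : ℝ) + 3) ^ 5) ≤ Real.log ((a : ℝ) ^ 6) := by
    apply Real.log_le_log (by positivity)
    obtain ⟨t, ht⟩ : ∃ t : ℝ, (a : ℝ) = 7 + t := ⟨a - 7, by ring⟩
    have ht0 : 0 ≤ t := by linarith
    rw [ht, ← sub_nonneg]
    ring_nf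
    positivity
  rw [Real.log_pow, Real.log_pow] at h
  push_cast at h
  linarith

theorem card_le_of_fundamental_domain {a : ℤ} (ha : 7 ≤ a) {B : ℝ} (hB : 10 ^ 12 * (a : ℝ) ^ 2 ≤ B)
    (Z : Finset (Fin 3 → ℤ)) (hne : ∀ n ∈ Z, ∀ i, conjVec a n i ≠ 0)
    (hpos : ∀ n ∈ Z, 0 < conjVec a n 0)
    (h0 : ∀ n ∈ Z, (unitMatrix a).mulVec (logVec a n) 0 ≤ 3 * Real.log B)
    (h1 : ∀ n ∈ Z, (unitMatrix a).mulVec (logVec a n) 1 ∈ Set.Ico 0 (3 * unitReg a))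
    (h2 : ∀ n ∈ Z, (unitMatrix a).mulVec (logVec a n) 2 ∈ Set.Ico 0 (3 * unitReg a)) :
    (Z.card : ℝ) ≤ 7 * (Real.log a ^ 2 / (a : ℝ) ^ 2) * B ^ 3 := by
  classical
  have ha' : (7 : ℝ) ≤ a := by exact_mod_cast ha
  have hBpos : 0 < B := by nlinarith
  let P : (Fin 3 → ℤ) → Prop := fun n =>
    (unitMatrix a).mulVec (logVec a n) 0 ≤ 3 * Real.log (B / 1000)
  have hsmall := card_small_le ha hB (Z.filter P)
    (fun n hn => hne n (Finset.mem_filter.1 hn).1) (fun n hn => (Finset.mem_filter.1 hn).2)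
    (fun n hn => h1 n (Finset.mem_filter.1 hn).1) (fun n hn => h2 n (Finset.mem_filter.1 hn).1)
  have hshell : ∀ y, _ := fun y => card_shell_le ha hB (abs_signVec y)
    ((Z.filter fun n => ¬ P n).filter fun n => ∀ i, 0 < signVec y i * conjVec a n i)
    (fun n hn => (Finset.mem_filter.1 hn).2)
    (fun n hn => by
      have := Finset.mem_filter.1 (Finset.mem_filter.1 hn).1
      exact ⟨(not_le.1 this.2).le, h0 n this.1⟩)
    (fun n hn => Set.Ico_subset_Icc_self
      (h1 n (Finset.mem_filter.1 (Finset.mem_filter.1 hn).1).1))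
    (fun n hn => Set.Ico_subset_Icc_self
      (h2 n (Finset.mem_filter.1 (Finset.mem_filter.1 hn).1).1))
  have hsum := card_eq_sum_signVec (a := a) (Z := Z.filter fun n => ¬ P n)
    (fun n hn => hne n (Finset.mem_filter.1 hn).1) (fun n hn => hpos n (Finset.mem_filter.1 hn).1)
  have hlarge : (((Z.filter fun n => ¬ P n).card : ℕ) : ℝ) * ((a : ℝ) ^ 2 + 3 * a + 9) ≤
      4 * (1.001 * unitReg a * B ^ 3) := by
    rw [hsum, Nat.cast_sum, Finset.sum_mul]
    refine (Finset.sum_le_card_nsmul _ _ _ fun y _ => hshell y).trans_eq ?_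
    simp
  have hcard : (Z.card : ℝ) = (Z.filter P).card + (Z.filter fun n => ¬ P n).card := by
    rw [← Nat.cast_add, Finset.card_filter_add_card_filter_not]
  have hlog := log_add_three_le ha
  have hlog0 : 0 ≤ Real.log (a + 3) := Real.log_nonneg (by linarith)
  have hR := (unitReg_bounds ha).2
  have hR2 : unitReg a ≤ 1.44 * Real.log a ^ 2 := by nlinarith
  have h3 : 0 < B ^ 3 := by positivity
  have h4 : unitReg a * B ^ 3 ≤ 1.44 * Real.log a ^ 2 * B ^ 3 := by gcongr
  have h5 : 0 ≤ Real.log a ^ 2 * B ^ 3 := by positivity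
  have h6 : (Z.card : ℝ) * (a : ℝ) ^ 2 ≤ Z.card * ((a : ℝ) ^ 2 + 3 * a + 9) := by
    gcongr; linarith
  rw [show 7 * (Real.log a ^ 2 / (a : ℝ) ^ 2) * B ^ 3 = 7 * (Real.log a ^ 2 * B ^ 3) / (a : ℝ) ^ 2 by
    ring, le_div_iff₀ (by positivity)]
  refine h6.trans ?_
  rw [hcard, add_mul]
  linarith

/-- Row `1` compares the outer logarithms, row `2` the middle one with the average of the others. -/
def diffMatrix : Matrix (Fin 3) (Fin 3) ℝ := !![1, 1, 1; 1, 0, -1; -1, 2, -1]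

theorem diffMatrix_mulVec (v : Fin 3 → ℝ) :
    diffMatrix.mulVec v 0 = v 0 + v 1 + v 2 ∧ diffMatrix.mulVec v 1 = v 0 - v 2 ∧
      diffMatrix.mulVec v 2 = 2 * v 1 - v 0 - v 2 := by
  refine ⟨?_, ?_, ?_⟩ <;> rw [mulVec_fin_three] <;> simp [diffMatrix] <;> ring

theorem diffMatrix_det : diffMatrix.det = 6 := by
  rw [Matrix.det_fin_three]
  simp [diffMatrix]
  norm_num

theorem sub_third_le {v : Fin 3 → ℝ} {c : ℝ} (h1 : |diffMatrix.mulVec v 1| ≤ c)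
    (h2 : |diffMatrix.mulVec v 2| ≤ c) (i : Fin 3) :
    diffMatrix.mulVec v 0 / 3 - c ≤ v i := by
  obtain ⟨e0, e1, e2⟩ := diffMatrix_mulVec v
  rw [e1, abs_le] at h1
  rw [e2, abs_le] at h2
  rw [e0]
  fin_cases i <;> simp only [Fin.zero_eta, Fin.mk_one, Fin.reduceFinMk] <;> linarith

theorem le_card_sector {a : ℤ} (ha : 7 ≤ a) {B : ℝ} (hB : 10 ^ 12 * (a : ℝ) ^ 2 ≤ B)
    {s : Fin 3 → ℝ} (hs : ∀ i, |s i| = 1) (Z : Finset (Fin 3 → ℤ))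
    (hZ : ∀ n, (∀ i, 0 < s i * conjVec a n i) →
      diffMatrix.mulVec (logVec a n) 0 ≤ 3 * Real.log B →
      |diffMatrix.mulVec (logVec a n) 1| ≤ 0.8 * Real.log a →
      |diffMatrix.mulVec (logVec a n) 2| ≤ 0.8 * Real.log a → n ∈ Z) :
    0.426 * Real.log a ^ 2 * B ^ 3 ≤ (Z.card : ℝ) * ((a : ℝ) ^ 2 + 3 * a + 9) := by
  have ha' : (7 : ℝ) ≤ a := by exact_mod_cast ha
  have hBpos : 0 < B := by nlinarith
  have hl : 1 ≤ Real.log a := by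
    rw [Real.le_log_iff_exp_le (by linarith)]
    linarith [Real.exp_one_lt_d9]
  set ℓ := Real.log a with hℓ
  set h : ℝ := 1 / 10 ^ 6 with hh
  set c : ℝ := 0.8 * ℓ with hc
  let lo : Fin 3 → ℝ := ![3 * Real.log (B / 1000), -c + 4 * h, -c + 4 * h]
  let hi : Fin 3 → ℝ := ![3 * Real.log B - 3 * h, c - 4 * h, c - 4 * h]
  have hlog : Real.log (B / 1000) + h ≤ Real.log B := by
    have h1000 : 1 ≤ Real.log 1000 := by
      rw [Real.le_log_iff_exp_le (by norm_num)]
      linarith [Real.exp_one_lt_d9]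
    rw [Real.log_div (by positivity) (by norm_num)]
    norm_num [hh]
    linarith
  have hhc : 8 * h ≤ 2 * c := by norm_num [hh, hc]; linarith
  have hlohi : lo ≤ hi := by
    intro i
    fin_cases i <;> simp [lo, hi] <;> linarith
  have hT0 : diffMatrix 0 = fun _ => 1 := by
    funext j
    fin_cases j <;> simp [diffMatrix]
  have hvol := volume_logBox hs hT0 (by rw [diffMatrix_det]; norm_num) hlohi
  refine le_card_mul_disc ha (E := logBox s diffMatrix lo hi) ?_ ?_
  · rw [hvol, diffMatrix_det, abs_of_pos (by norm_num : (0 : ℝ) < 6)]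
    apply ENNReal.ofReal_le_ofReal
    have e0 : ∀ y : ℝ, 0 < y → Real.exp (3 * Real.log y) = y ^ 3 := fun y hy => by
      rw [show 3 * Real.log y = Real.log (y ^ 3) by rw [Real.log_pow]; norm_num,
        Real.exp_log (by positivity)]
    have h3 : 0 < B ^ 3 := by positivity
    have e1 : (1 - 1 / 10 ^ 5) * B ^ 3 ≤ Real.exp (hi 0) - Real.exp (lo 0) := by
      simp only [hi, lo, Matrix.cons_val_zero]
      rw [sub_eq_add_neg (3 * Real.log B), Real.exp_add, e0 _ hBpos, e0 _ (by positivity)]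
      have := Real.one_sub_le_exp_neg (3 * h)
      have h4 : 1 - 3 * h = 1 - 3 / 10 ^ 6 := by rw [hh]; ring
      rw [h4] at this
      nlinarith
    have e2 : 1.59999 * ℓ ≤ hi 1 - lo 1 := by
      simp only [hi, lo, Matrix.cons_val_one, Matrix.cons_val_zero]
      norm_num [hh, hc]
      linarith
    have e3 : hi 2 - lo 2 = hi 1 - lo 1 := by simp [hi, lo]
    rw [e3, le_div_iff₀ (by norm_num)]
    calc 0.426 * ℓ ^ 2 * B ^ 3 * 6 ≤ ((1 - 1 / 10 ^ 5) * B ^ 3) * (1.59999 * ℓ) * (1.59999 * ℓ) := by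
          have : 0 < ℓ ^ 2 * B ^ 3 := by positivity
          linarith
      _ ≤ _ := by
          have : 0 ≤ (1 - 1 / 10 ^ 5) * B ^ 3 := by norm_num; positivity
          have := this.trans e1
          have := mul_nonneg this (e2.trans' (by positivity))
          gcongr
  · intro z hz n hn
    obtain ⟨hzpos, hlo, hhi⟩ := hz
    have hm : ∀ i, B / 1000 / a ≤ s i * z i := by
      intro i
      refine le_mul_of_log_le (hs i) (hzpos i) (by positivity) ?_
      rw [Real.log_div (by positivity) (by positivity)]
      have k1 : |diffMatrix.mulVec (fun i => Real.log (z i)) 1| ≤ ℓ := by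
        have t1 := hlo 1
        have t2 := hhi 1
        simp only [hi, lo, Matrix.cons_val_one, Matrix.cons_val_zero] at t1 t2
        rw [abs_le]
        norm_num [hh, hc] at t1 t2 ⊢
        constructor <;> linarith
      have k2 : |diffMatrix.mulVec (fun i => Real.log (z i)) 2| ≤ ℓ := by
        have t1 := hlo 2
        have t2 := hhi 2
        simp only [hi, lo, Matrix.cons_val] at t1 t2
        rw [abs_le]
        norm_num [hh, hc] at t1 t2 ⊢
        constructor <;> linarith
      have := sub_third_le k1 k2 i
      have t1 := hlo 0
      simp only [lo, Matrix.cons_val_zero] at t1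
      linarith
    have hd : 3 * (a : ℝ) ≤ h / 2 * (B / 1000 / a) := by
      rw [hh, div_div, mul_div_assoc', le_div_iff₀ (by positivity)]
      nlinarith
    have hcl : ∀ i, 0 < s i * conjVec a n i ∧
        |Real.log (conjVec a n i) - Real.log (z i)| ≤ h := fun i =>
      log_close (hs i) (by positivity) (hm i) (by norm_num [hh]) hd (by
        rw [abs_sub_comm]; exact hn i)
    have hT : ∀ i, |diffMatrix.mulVec (logVec a n) i -
        diffMatrix.mulVec (fun i => Real.log (z i)) i| ≤
        (|diffMatrix i 0| + |diffMatrix i 1| + |diffMatrix i 2|) * h :=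
      fun i => abs_mulVec_sub_le (fun i => (hcl i).2) i
    have r0 : |diffMatrix 0 0| + |diffMatrix 0 1| + |diffMatrix 0 2| = 3 := by
      norm_num [hT0]
    have r1 : |diffMatrix 1 0| + |diffMatrix 1 1| + |diffMatrix 1 2| ≤ 4 := by
      simp only [diffMatrix, Matrix.cons_val, Matrix.of_apply]
      norm_num
    have r2 : |diffMatrix 2 0| + |diffMatrix 2 1| + |diffMatrix 2 2| ≤ 4 := by
      simp only [diffMatrix, Matrix.cons_val, Matrix.of_apply]
      norm_num
    have hhpos : 0 < h := by norm_num [hh]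
    have c0 := mem_Icc_of_abs_sub_le ((hT 0).trans_eq (by rw [r0])) ⟨hlo 0, hhi 0⟩
    have c1 := mem_Icc_of_abs_sub_le
      ((hT 1).trans (mul_le_mul_of_nonneg_right r1 hhpos.le)) ⟨hlo 1, hhi 1⟩
    have c2 := mem_Icc_of_abs_sub_le
      ((hT 2).trans (mul_le_mul_of_nonneg_right r2 hhpos.le)) ⟨hlo 2, hhi 2⟩
    simp only [hi, lo, Matrix.cons_val_one, Matrix.cons_val_zero, Matrix.cons_val,
      Set.mem_Icc] at c0 c1 c2
    refine hZ n (fun i => (hcl i).1) (by linarith [c0.2]) (abs_le.2 ?_) (abs_le.2 ?_)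
    · constructor <;> linarith [c1.1, c1.2]
    · constructor <;> linarith [c2.1, c2.2]

theorem le_card_of_thin {a : ℤ} (ha : 7 ≤ a) {B : ℝ} (hB : 10 ^ 12 * (a : ℝ) ^ 2 ≤ B)
    (Z : Finset (Fin 3 → ℤ))
    (hZ : ∀ n, n ∈ Z ↔ (∀ i, conjVec a n i ≠ 0) ∧ 0 < conjVec a n 0 ∧
      diffMatrix.mulVec (logVec a n) 0 ≤ 3 * Real.log B ∧
      |diffMatrix.mulVec (logVec a n) 1| ≤ 0.8 * Real.log a ∧
      |diffMatrix.mulVec (logVec a n) 2| ≤ 0.8 * Real.log a) :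
    Real.log a ^ 2 / (a : ℝ) ^ 2 * B ^ 3 ≤ (Z.card : ℝ) := by
  classical
  have ha' : (7 : ℝ) ≤ a := by exact_mod_cast ha
  have hBpos : 0 < B := by nlinarith
  have hsector : ∀ y, 0.426 * Real.log a ^ 2 * B ^ 3 ≤
      ((Z.filter fun n => ∀ i, 0 < signVec y i * conjVec a n i).card : ℝ) *
        ((a : ℝ) ^ 2 + 3 * a + 9) := fun y =>
    le_card_sector ha hB (abs_signVec y) _ fun n hn h0 h1 h2 => by
      refine Finset.mem_filter.2 ⟨(hZ n).2 ⟨fun i hi => ?_, ?_, h0, h1, h2⟩, hn⟩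
      · simpa [hi] using hn i
      · simpa [signVec] using hn 0
  have hsum := card_eq_sum_signVec (a := a) (Z := Z) (fun n hn => ((hZ n).1 hn).1)
    (fun n hn => ((hZ n).1 hn).2.1)
  have hall : 4 * (0.426 * Real.log a ^ 2 * B ^ 3) ≤
      (Z.card : ℝ) * ((a : ℝ) ^ 2 + 3 * a + 9) := by
    rw [hsum, Nat.cast_sum, Finset.sum_mul]
    refine Eq.trans_le ?_ (Finset.card_nsmul_le_sum _ _ _ fun y _ => hsector y)
    simp
  have hQ : (a : ℝ) ^ 2 + 3 * a + 9 ≤ 79 / 49 * (a : ℝ) ^ 2 := by nlinarith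
  have h1 : (Z.card : ℝ) * ((a : ℝ) ^ 2 + 3 * a + 9) ≤ Z.card * (79 / 49 * (a : ℝ) ^ 2) := by
    gcongr
  have h2 : 0 ≤ Real.log a ^ 2 * B ^ 3 := by positivity
  rw [div_mul_eq_mul_div, div_le_iff₀ (by positivity)]
  linarith

theorem conjVec_single (a : ℤ) (i : Fin 3) :
    conjVec a ![0, 1, 0] i = cubicConj a i ∧ conjVec a ![0, 0, 1] i = cubicConj a (i + 1) := by
  simp [conjVec, conjMatrix_mulVec]

theorem prod_cubicConj {a : ℤ} (ha : 7 ≤ a) : cubicConj a 0 * cubicConj a 1 * cubicConj a 2 = 1 := by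
  obtain ⟨h1, h2, h3, h4⟩ := cubicConj_rel ha
  grind

section field

variable {a : ℤ} (ha : 7 ≤ a) {K : Type} [Field K] [NumberField K] {τ : Fin 3 → K →+* ℝ}
  (hnorm : ∀ x : K, ((Algebra.norm ℚ x : ℚ) : ℝ) = ∏ i, τ i x)
  {φ : (Fin 3 → ℤ) → 𝓞 K} (hφ : Function.Bijective φ) (hφ0 : ∀ n, φ n = 0 ↔ n = 0)
  (hval : ∀ n i, τ i (φ n) = conjVec a n i)

include hnorm hval in
theorem absNorm_span_eq (n : Fin 3 → ℤ) :
    (Ideal.absNorm (Ideal.span {φ n}) : ℝ) = |conjVec a n 0| * |conjVec a n 1| * |conjVec a n 2| := by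
  rw [Ideal.absNorm_span_singleton, ← abs_mul, ← abs_mul]
  have h := hnorm (φ n)
  rw [← Algebra.coe_norm_int, Fin.prod_univ_three, hval, hval, hval] at h
  rw [← h, Nat.cast_natAbs]
  push_cast
  rfl

omit [NumberField K] in
include hφ0 hval in
theorem conjVec_ne_zero {n : Fin 3 → ℤ} (hn : n ≠ 0) (i : Fin 3) : conjVec a n i ≠ 0 := by
  rw [← hval, Ne, map_eq_zero, RingOfIntegers.coe_eq_zero_iff, hφ0]
  exact hn

include hnorm hφ0 hval in
theorem absNorm_span_le_iff {n : Fin 3 → ℤ} (hn : n ≠ 0) {B : ℝ} (hB : 0 < B) :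
    (Ideal.absNorm (Ideal.span {φ n}) : ℝ) ≤ B ^ 3 ↔
      logVec a n 0 + logVec a n 1 + logVec a n 2 ≤ 3 * Real.log B := by
  have h := fun i => abs_pos.2 (conjVec_ne_zero hφ0 hval hn i)
  rw [absNorm_span_eq hnorm hval,
    ← Real.log_le_log_iff (mul_pos (mul_pos (h 0) (h 1)) (h 2)) (by positivity),
    Real.log_mul (mul_pos (h 0) (h 1)).ne' (h 2).ne', Real.log_mul (h 0).ne' (h 1).ne',
    Real.log_abs, Real.log_abs, Real.log_abs, Real.log_pow]
  norm_num [logVec]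

include hnorm hval in
theorem isUnit_of_prod {n : Fin 3 → ℤ}
    (h : conjVec a n 0 * conjVec a n 1 * conjVec a n 2 = 1) : IsUnit (φ n) := by
  rw [← Ideal.span_singleton_eq_top, ← Ideal.absNorm_eq_one_iff]
  have := absNorm_span_eq hnorm hval n
  rw [← abs_mul, ← abs_mul, h, abs_one] at this
  exact_mod_cast this

theorem map_zpow_units {R F : Type*} [CommRing R] [Field F] (f : R →+* F) (u : Rˣ) (k : ℤ) :
    f ((u ^ k : Rˣ) : R) = f u ^ k := by
  have := congrArg Units.val (map_zpow (Units.map (f : R →* F)) u k)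
  rwa [Units.val_zpow_eq_zpow_val] at this

include ha hnorm hφ hφ0 hval in
/-- Every nonzero principal ideal has a generator in the fundamental domain of the units. -/
theorem exists_generator {I : Ideal (𝓞 K)} (hI : I ≠ ⊥) (hp : Submodule.IsPrincipal I) :
    ∃ n, Ideal.span {φ n} = I ∧ n ≠ 0 ∧ 0 < conjVec a n 0 ∧
      (unitMatrix a).mulVec (logVec a n) 1 ∈ Set.Ico 0 (3 * unitReg a) ∧
      (unitMatrix a).mulVec (logVec a n) 2 ∈ Set.Ico 0 (3 * unitReg a) := by
  obtain ⟨α, hα⟩ := hp.principal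
  obtain ⟨m, rfl⟩ := hφ.2 α
  rw [Ideal.submodule_span_eq] at hα
  have hm : m ≠ 0 := fun h => hI (by rw [hα, (hφ0 m).2 h, Ideal.span_singleton_eq_bot])
  have hRpos : 0 < 3 * unitReg a := by
    have := (unitReg_bounds ha).1
    have := (unitLog_spec ha).2.1
    nlinarith
  have hc0 : ∀ i, cubicConj a i ≠ 0 := fun i => by
    obtain ⟨h1, h2, ⟨h3, h4⟩, h5, h6⟩ := cubicConj_bounds ha
    have ha' : (7 : ℝ) ≤ a := by exact_mod_cast ha
    fin_cases i <;> simp only [Fin.zero_eta, Fin.mk_one, Fin.reduceFinMk] <;>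
      first | exact h4.ne | exact (by linarith : (0 : ℝ) < _).ne' |
        exact (by linarith : _ < (0 : ℝ)).ne
  obtain ⟨u, hu⟩ : IsUnit (φ ![0, 1, 0]) := isUnit_of_prod hnorm hval (by
    rw [(conjVec_single a 0).1, (conjVec_single a 1).1, (conjVec_single a 2).1,
      prod_cubicConj ha])
  obtain ⟨u', hu'⟩ : IsUnit (φ ![0, 0, 1]) := isUnit_of_prod hnorm hval (by
    rw [(conjVec_single a 0).2, (conjVec_single a 1).2, (conjVec_single a 2).2,
      ← prod_cubicConj ha, show (0 : Fin 3) + 1 = 1 from rfl, show (1 : Fin 3) + 1 = 2 from rfl,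
          show (2 : Fin 3) + 1 = 0 from rfl]
    ring)
  let τ' : Fin 3 → 𝓞 K →+* ℝ := fun i => (τ i).comp (algebraMap (𝓞 K) K)
  have hτ' : ∀ n i, τ' i (φ n) = conjVec a n i := hval
  let j : ℤ := -⌊(unitMatrix a).mulVec (logVec a m) 1 / (3 * unitReg a)⌋
  let k : ℤ := -⌊(unitMatrix a).mulVec (logVec a m) 2 / (3 * unitReg a)⌋
  obtain ⟨n, hn⟩ := hφ.2 (φ m * ((u ^ j * u' ^ k : (𝓞 K)ˣ) : 𝓞 K))
  have hconj : ∀ i, conjVec a n i = conjVec a m i * (cubicConj a i ^ j * cubicConj a (i + 1) ^ k) := by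
    intro i
    rw [← hτ', hn, map_mul, Units.val_mul, map_mul, map_zpow_units, map_zpow_units, hu, hu',
      hτ', hτ', hτ', (conjVec_single a i).1, (conjVec_single a i).2]
  have hspan : Ideal.span {φ n} = I := by
    rw [hn, Ideal.span_singleton_mul_right_unit (Units.isUnit _), hα]
  have hn0 : n ≠ 0 := fun h => hI (by
    rw [← hspan, (hφ0 n).2 h, Ideal.span_singleton_eq_bot])
  have hlog : logVec a n =
      fun i => logVec a m i + j * unitLog a i + k * unitLog a (i + 1) := by
    funext i
    rw [logVec, hconj, Real.log_mul (conjVec_ne_zero hφ0 hval hm i)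
      (mul_ne_zero (zpow_ne_zero _ (hc0 _)) (zpow_ne_zero _ (hc0 _))),
      Real.log_mul (zpow_ne_zero _ (hc0 _)) (zpow_ne_zero _ (hc0 _)), Real.log_zpow,
      Real.log_zpow, logVec, unitLog, unitLog, add_assoc]
  have hfloor : ∀ t : ℝ, t + ((-⌊t / (3 * unitReg a)⌋ : ℤ) : ℝ) * (3 * unitReg a) ∈
      Set.Ico 0 (3 * unitReg a) := by
    intro t
    have h1 := Int.floor_le (t / (3 * unitReg a))
    have h2 := Int.lt_floor_add_one (t / (3 * unitReg a))
    rw [le_div_iff₀ hRpos] at h1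
    rw [div_lt_iff₀ hRpos] at h2
    push_cast
    constructor <;> linarith
  have hT1 : (unitMatrix a).mulVec (logVec a n) 1 ∈ Set.Ico 0 (3 * unitReg a) := by
    rw [hlog, (unitMatrix_mulVec_add_units ha _ _ _).1]
    exact hfloor _
  have hT2 : (unitMatrix a).mulVec (logVec a n) 2 ∈ Set.Ico 0 (3 * unitReg a) := by
    rw [hlog, (unitMatrix_mulVec_add_units ha _ _ _).2]
    exact hfloor _
  rcases lt_or_gt_of_ne (conjVec_ne_zero hφ0 hval hn0 0) with hneg | hpos
  · obtain ⟨l, hl⟩ := hφ.2 (-φ n)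
    have hl' : ∀ i, conjVec a l i = -conjVec a n i := fun i => by
      rw [← hτ', hl, map_neg, hτ']
    have hll : logVec a l = logVec a n := by
      funext i
      rw [logVec, hl', Real.log_neg_eq_log, logVec]
    refine ⟨l, by rw [hl, Ideal.span_singleton_neg, hspan], fun h => hn0 ?_, ?_, ?_, ?_⟩
    · rw [← hφ0, ← neg_eq_zero, ← hl, hφ0, h]
    · rw [hl']; linarith
    · rwa [hll]
    · rwa [hll]
  · exact ⟨n, hspan, hn0, hpos, hT1, hT2⟩

end field

theorem abs_prod_sub_le {y : Fin 3 → ℝ} {M : ℝ} (h : ∀ i j, i ≠ j → |y i| * y j ^ 2 ≤ M) :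
    |(y 0 - y 1) * (y 1 - y 2) * (y 2 - y 0)| ≤ 3 * M := by
  have key : ∀ i j k, i ≠ j → i ≠ k → |y i * (y j ^ 2 - y k ^ 2)| ≤ M := by
    intro i j k hij hik
    have h1 := h i j hij
    have h2 := h i k hik
    have h3 : 0 ≤ |y i| * y j ^ 2 := by positivity
    have h4 : 0 ≤ |y i| * y k ^ 2 := by positivity
    have e : |y i * (y j ^ 2 - y k ^ 2)| = |(|y i|) * (y j ^ 2 - y k ^ 2)| := by
      rw [abs_mul, abs_mul, abs_abs]
    rw [e, abs_le]
    constructor <;> linarith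
  have e : (y 0 - y 1) * (y 1 - y 2) * (y 2 - y 0) =
      y 0 * (y 1 ^ 2 - y 2 ^ 2) + y 1 * (y 2 ^ 2 - y 0 ^ 2) + y 2 * (y 0 ^ 2 - y 1 ^ 2) := by ring
  rw [e]
  refine (abs_add_three _ _ _).trans ?_
  have h0 := key 0 1 2 (by decide) (by decide)
  have h1 := key 1 2 0 (by decide) (by decide)
  have h2 := key 2 0 1 (by decide) (by decide)
  linarith

theorem three_mul_exp_lt {a : ℤ} (ha : 7 ≤ a) :
    3 * Real.exp (1.6 * Real.log a) < (a : ℝ) ^ 2 + 3 * a + 9 := by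
  have ha' : (7 : ℝ) ≤ a := by exact_mod_cast ha
  refine lt_of_pow_lt_pow_left₀ 5 (by positivity) ?_
  have : Real.exp (1.6 * Real.log a) ^ 5 = (a : ℝ) ^ 8 := by
    rw [← Real.exp_nat_mul, show ((5 : ℕ) : ℝ) * (1.6 * Real.log a) = Real.log ((a : ℝ) ^ 8) by
      rw [Real.log_pow]; push_cast; ring, Real.exp_log (by positivity)]
  rw [mul_pow, this]
  obtain ⟨t, ht⟩ : ∃ t : ℝ, (a : ℝ) = 7 + t := ⟨a - 7, by ring⟩
  have ht0 : 0 ≤ t := by linarith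
  rw [ht, ← sub_pos]
  ring_nf
  positivity

theorem exists_add_add_eq (v : Fin 3 → ℝ) {i j : Fin 3} (hij : i ≠ j) :
    ∃ k, v i + v j + v k = v 0 + v 1 + v 2 := by
  refine ⟨-(i + j), ?_⟩
  have h : ∀ k l : Fin 3, k ≠ l → Finset.univ = ({k, l, -(k + l)} : Finset (Fin 3)) := by decide
  have h' : ∀ k l : Fin 3, k ≠ l → l ≠ -(k + l) ∧ k ≠ -(k + l) := by decide
  obtain ⟨h1, h2⟩ := h' i j hij
  rw [← Fin.sum_univ_three, h i j hij,
    Finset.sum_insert (Finset.mem_insert.not.2 (not_or.2 ⟨hij, Finset.mem_singleton.not.2 h2⟩)),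
    Finset.sum_pair h1, add_assoc]

/-- A unit whose conjugates have nearly equal absolute values is rational. -/
theorem conjVec_const_of_close {a : ℤ} (ha : 7 ≤ a) {e : Fin 3 → ℤ}
    (hne : ∀ i, conjVec a e i ≠ 0) (hsum : logVec a e 0 + logVec a e 1 + logVec a e 2 = 0)
    (hclose : ∀ i j, logVec a e i - logVec a e j ≤ 1.6 * Real.log a) (i : Fin 3) :
    |conjVec a e i| = 1 ∧ conjVec a e i = conjVec a e 0 := by
  have hM : ∀ i j, i ≠ j → |conjVec a e i| * conjVec a e j ^ 2 ≤ Real.exp (1.6 * Real.log a) := by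
    intro i j hij
    have hi := abs_pos.2 (hne i)
    have hj := abs_pos.2 (hne j)
    rw [← sq_abs (conjVec a e j), ← Real.log_le_iff_le_exp (by positivity),
      Real.log_mul (by positivity) (by positivity), Real.log_pow, Real.log_abs, Real.log_abs]
    obtain ⟨k, hk⟩ := exists_add_add_eq (logVec a e) hij
    rw [hsum] at hk
    have := hclose j k
    unfold logVec at this hk
    push_cast
    linarith
  have h1 := abs_prod_sub_le hM
  have hy : ∀ i, conjVec a e i = (e 0 : ℝ) + e 1 * cubicConj a i + e 2 * cubicConj a (i + 1) :=
    fun i => by rw [conjVec, conjMatrix_mulVec]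
  rw [prod_sub_eq_indexForm ha _ _ _ _ hy] at h1
  have h2 := h1.trans_lt (three_mul_exp_lt ha)
  have ha' : (7 : ℝ) ≤ a := by exact_mod_cast ha
  have hQ : 0 < (a : ℝ) ^ 2 + 3 * a + 9 := by positivity
  rw [abs_mul, abs_of_pos hQ] at h2
  have h3 : |(-(e 1 : ℝ) ^ 3 + (a + 3) * (e 1 : ℝ) ^ 2 * e 2 - a * e 1 * (e 2 : ℝ) ^ 2 -
      (e 2 : ℝ) ^ 3)| < 1 := by
    by_contra! hcon
    nlinarith
  have h4 : |(-(e 1) ^ 3 + (a + 3) * (e 1) ^ 2 * e 2 - a * e 1 * (e 2) ^ 2 - (e 2) ^ 3)| < 1 := by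
    exact_mod_cast h3
  obtain ⟨hv, hw⟩ := indexForm_eq_zero a _ (e 1) (e 2) le_rfl (Int.abs_lt_one_iff.1 h4)
  have hconst : ∀ i, conjVec a e i = e 0 := fun i => by rw [hy, hv, hw]; simp
  refine ⟨?_, by rw [hconst, hconst]⟩
  unfold logVec at hsum
  rw [hconst, hconst, hconst] at hsum
  have h0 : |(e 0 : ℝ)| ≠ 0 := abs_ne_zero.2 (hconst 0 ▸ hne 0)
  have hl : Real.log |(e 0 : ℝ)| = 0 := by rw [Real.log_abs]; linarith
  rw [hconst]
  exact Real.eq_one_of_pos_of_log_eq_zero (lt_of_le_of_ne (abs_nonneg _) h0.symm) hl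

theorem sub_le_of_diffMatrix {v : Fin 3 → ℝ} {c : ℝ} (h1 : |diffMatrix.mulVec v 1| ≤ c)
    (h2 : |diffMatrix.mulVec v 2| ≤ c) (i j : Fin 3) : v i - v j ≤ c := by
  obtain ⟨-, e1, e2⟩ := diffMatrix_mulVec v
  rw [e1] at h1
  rw [e2] at h2
  obtain ⟨h1, h1'⟩ := abs_le.1 h1
  obtain ⟨h2, h2'⟩ := abs_le.1 h2
  fin_cases i <;> fin_cases j <;> simp only [Fin.zero_eta, Fin.mk_one, Fin.reduceFinMk] <;> linarith

section field

variable {a : ℤ} (ha : 7 ≤ a) {K : Type} [Field K] [NumberField K] {τ : Fin 3 → K →+* ℝ}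
  (hnorm : ∀ x : K, ((Algebra.norm ℚ x : ℚ) : ℝ) = ∏ i, τ i x)
  {φ : (Fin 3 → ℤ) → 𝓞 K} (hφ : Function.Bijective φ) (hφ0 : ∀ n, φ n = 0 ↔ n = 0)
  (hval : ∀ n i, τ i (φ n) = conjVec a n i)

include ha hnorm hφ hφ0 hval in
theorem span_injOn_thin {c : ℝ} (hc : c ≤ 0.8 * Real.log a) :
    Set.InjOn (fun n => Ideal.span {φ n}) {n | n ≠ 0 ∧ 0 < conjVec a n 0 ∧
      |diffMatrix.mulVec (logVec a n) 1| ≤ c ∧ |diffMatrix.mulVec (logVec a n) 2| ≤ c} := by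
  rintro m ⟨hm0, hm, hm1, hm2⟩ n ⟨hn0, hn, hn1, hn2⟩ hmn
  obtain ⟨u, hu⟩ := Ideal.span_singleton_eq_span_singleton.1 hmn
  obtain ⟨e, he⟩ := hφ.2 (u : 𝓞 K)
  let τ' : Fin 3 → 𝓞 K →+* ℝ := fun i => (τ i).comp (algebraMap (𝓞 K) K)
  have hτ' : ∀ n i, τ' i (φ n) = conjVec a n i := hval
  have hconj : ∀ i, conjVec a n i = conjVec a m i * conjVec a e i := fun i => by
    rw [← hτ', ← hu, ← he, map_mul, hτ', hτ']
  have hmne := conjVec_ne_zero hφ0 hval hm0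
  have hnne := conjVec_ne_zero hφ0 hval hn0
  have hene : ∀ i, conjVec a e i ≠ 0 := fun i h => hnne i (by rw [hconj, h, mul_zero])
  have hlog : ∀ i, logVec a n i = logVec a m i + logVec a e i := fun i => by
    rw [logVec, hconj, Real.log_mul (hmne i) (hene i), logVec, logVec]
  have hN : |conjVec a e 0| * |conjVec a e 1| * |conjVec a e 2| = 1 := by
    rw [← absNorm_span_eq hnorm hval, he, Ideal.span_singleton_eq_top.2 u.isUnit,
      Ideal.absNorm_top, Nat.cast_one]
  have hsum : logVec a e 0 + logVec a e 1 + logVec a e 2 = 0 := by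
    have h := congrArg Real.log hN
    have h' := fun i => abs_ne_zero.2 (hene i)
    rw [Real.log_mul (mul_ne_zero (h' 0) (h' 1)) (h' 2), Real.log_mul (h' 0) (h' 1),
      Real.log_abs, Real.log_abs, Real.log_abs, Real.log_one] at h
    exact h
  have hclose : ∀ i j, logVec a e i - logVec a e j ≤ 1.6 * Real.log a := fun i j => by
    have h1 := sub_le_of_diffMatrix hn1 hn2 i j
    have h2 := sub_le_of_diffMatrix hm1 hm2 j i
    rw [hlog, hlog] at h1
    linarith
  have hconst := conjVec_const_of_close ha hene hsum hclose
  have hpos : 0 < conjVec a e 0 := by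
    rw [hconj] at hn
    exact (mul_pos_iff_of_pos_left hm).1 hn
  have hone : ∀ i, conjVec a e i = 1 := fun i => by
    rw [(hconst i).2, ← abs_of_pos hpos, (hconst 0).1]
  have hvec : conjVec a m = conjVec a n := funext fun i => by rw [hconj, hone, mul_one]
  have := mulVec_injective_of_det_ne_zero (conjMatrix_det_ne_zero ha) hvec
  funext j
  exact_mod_cast congrFun this j

include ha hnorm hφ hφ0 hval in
theorem card_principal_ideals_bounds {B : ℝ} (hB : 10 ^ 12 * (a : ℝ) ^ 2 ≤ B) :
    Real.log a ^ 2 / (a : ℝ) ^ 2 * B ^ 3 ≤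
        (Set.ncard {I : Ideal (𝓞 K) |
          I ≠ ⊥ ∧ Submodule.IsPrincipal I ∧ (Ideal.absNorm I : ℝ) ≤ B ^ 3} : ℝ) ∧
      (Set.ncard {I : Ideal (𝓞 K) |
          I ≠ ⊥ ∧ Submodule.IsPrincipal I ∧ (Ideal.absNorm I : ℝ) ≤ B ^ 3} : ℝ) ≤
        7 * (Real.log a ^ 2 / (a : ℝ) ^ 2) * B ^ 3 := by
  classical
  have ha' : (7 : ℝ) ≤ a := by exact_mod_cast ha
  have hBpos : 0 < B := by nlinarith
  set S := {I : Ideal (𝓞 K) | I ≠ ⊥ ∧ Submodule.IsPrincipal I ∧ (Ideal.absNorm I : ℝ) ≤ B ^ 3}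
    with hS
  have hSfin : S.Finite := by
    refine (Ideal.finite_setOfPred_absNorm_le (S := 𝓞 K) ⌊B ^ 3⌋₊).subset fun I hI => ?_
    exact Nat.le_floor hI.2.2
  have hbot : ∀ n, n ≠ 0 → Ideal.span {φ n} ≠ ⊥ := fun n hn h =>
    hn ((hφ0 n).1 (Ideal.span_singleton_eq_bot.1 h))
  constructor
  · let Y : Set (Fin 3 → ℤ) := {n | n ≠ 0 ∧ 0 < conjVec a n 0 ∧
      diffMatrix.mulVec (logVec a n) 0 ≤ 3 * Real.log B ∧
      |diffMatrix.mulVec (logVec a n) 1| ≤ 0.8 * Real.log a ∧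
      |diffMatrix.mulVec (logVec a n) 2| ≤ 0.8 * Real.log a}
    have hinj : Set.InjOn (fun n => Ideal.span {φ n}) Y :=
      Set.InjOn.mono (fun n hn => And.intro hn.1 ⟨hn.2.1, hn.2.2.2⟩)
        (span_injOn_thin ha hnorm hφ hφ0 hval le_rfl)
    have hmaps : Set.MapsTo (fun n => Ideal.span {φ n}) Y S := by
      intro n hn
      simp only [hS, Set.mem_ofPred_eq]
      refine ⟨hbot n hn.1, ⟨⟨φ n, rfl⟩⟩, (absNorm_span_le_iff hnorm hφ0 hval hn.1 hBpos).2 ?_⟩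
      rw [← (diffMatrix_mulVec _).1]
      exact hn.2.2.1
    have hYfin : Y.Finite := Set.Finite.of_injOn hmaps hinj hSfin
    have h1 : Y.ncard ≤ S.ncard := Set.ncard_le_ncard_of_injOn _ hmaps hinj hSfin
    have h2 := le_card_of_thin ha hB hYfin.toFinset fun n => by
      rw [Set.Finite.mem_toFinset]
      refine and_congr_left fun _ => ⟨fun h => conjVec_ne_zero hφ0 hval h, ?_⟩
      rintro h rfl
      exact h 0 (by
        rw [conjVec, conjMatrix_mulVec]
        simp)
    rw [← Set.ncard_eq_toFinset_card Y hYfin] at h2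
    exact h2.trans (by exact_mod_cast h1)
  · have hgen : ∀ I : S, ∃ n, Ideal.span {φ n} = (I : Ideal (𝓞 K)) ∧ n ≠ 0 ∧ 0 < conjVec a n 0 ∧
        (unitMatrix a).mulVec (logVec a n) 1 ∈ Set.Ico 0 (3 * unitReg a) ∧
        (unitMatrix a).mulVec (logVec a n) 2 ∈ Set.Ico 0 (3 * unitReg a) := fun I =>
      exists_generator ha hnorm hφ hφ0 hval I.2.1 I.2.2.1
    choose g hg hg0 hgpos hg1 hg2 using hgen
    have hginj : Function.Injective g := fun I J hIJ =>
      Subtype.ext (by rw [← hg I, hIJ, hg J])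
    have : Fintype S := hSfin.fintype
    have hcard : S.ncard = (Finset.univ.image g).card := by
      rw [Finset.card_image_of_injective _ hginj, Finset.card_univ, ← Nat.card_coe_set_eq,
        Nat.card_eq_fintype_card]
    rw [hcard]
    refine card_le_of_fundamental_domain ha hB _ ?_ ?_ ?_ ?_ ?_ <;> intro n hn <;>
      obtain ⟨I, -, rfl⟩ := Finset.mem_image.1 hn
    · exact conjVec_ne_zero hφ0 hval (hg0 I)
    · exact hgpos I
    · rw [(unitMatrix_mulVec a _).1, ← absNorm_span_le_iff hnorm hφ0 hval (hg0 I) hBpos, hg]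
      exact I.2.2.2
    · exact hg1 I
    · exact hg2 I

end field

theorem exists_cube_root {a : ℤ} (ha : 7 ≤ a) {x : ℝ}
    (hx : ((3 : ℝ) ^ (900 : ℕ) * ((3 : ℝ) / 2) ^ ((5 : ℝ) / 3)) ^ 3 * (a : ℝ) ^ 6
            * (Real.log a) ^ 4 ≤ x) : ∃ B : ℝ, B ^ 3 = x ∧ 10 ^ 12 * (a : ℝ) ^ 2 ≤ B := by
  have ha' : (7 : ℝ) ≤ a := by exact_mod_cast ha
  have hl : 1 ≤ Real.log a := by
    rw [Real.le_log_iff_exp_le (by linarith)]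
    linarith [Real.exp_one_lt_d9]
  have h1 : (1 : ℝ) ≤ ((3 : ℝ) / 2) ^ ((5 : ℝ) / 3) :=
    Real.one_le_rpow (by norm_num) (by norm_num)
  have h2 : (10 : ℝ) ^ 12 ≤ 3 ^ 900 :=
    calc (10 : ℝ) ^ 12 ≤ 3 ^ 26 := by norm_num
      _ ≤ 3 ^ 900 := pow_le_pow_right₀ (by norm_num) (by norm_num)
  have hx' : (10 ^ 12 * (a : ℝ) ^ 2) ^ 3 ≤ x := by
    refine le_trans ?_ hx
    calc (10 ^ 12 * (a : ℝ) ^ 2) ^ 3 = (10 ^ 12 * 1) ^ 3 * (a : ℝ) ^ 6 * 1 ^ 4 := by ring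
      _ ≤ _ := by gcongr
  have hx0 : 0 ≤ x := le_trans (by positivity) hx'
  have hcube : (x ^ ((1 : ℝ) / 3)) ^ 3 = x := by
    rw [← Real.rpow_natCast, ← Real.rpow_mul hx0]
    norm_num
  refine ⟨x ^ ((1 : ℝ) / 3), hcube, le_of_pow_le_pow_left₀ (n := 3) (by norm_num) (by positivity) ?_⟩
  rwa [hcube]

theorem stmt_3 :
    ∀ (a : ℤ), 7 ≤ a →
    ∀ (K : Type) [Field K] [NumberField K] (σ : K →+* ℝ) (ρK : K),
      σ ρK = simplestCubicRoot a →
      IntermediateField.adjoin ℚ {ρK} = ⊤ →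
      Algebra.adjoin ℤ {ρK} = integralClosure ℤ K →
      ∀ x : ℝ,
        ((3 : ℝ) ^ (900 : ℕ) * ((3 : ℝ) / 2) ^ ((5 : ℝ) / 3)) ^ 3 * (a : ℝ) ^ 6
            * (Real.log a) ^ 4 ≤ x →
        ((Real.log a) ^ 2 / (a : ℝ) ^ 2) * x ≤
            (Set.ncard {I : Ideal (RingOfIntegers K) |
              I ≠ ⊥ ∧ Submodule.IsPrincipal I ∧ (Ideal.absNorm I : ℝ) ≤ x} : ℝ) ∧
          (Set.ncard {I : Ideal (RingOfIntegers K) |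
              I ≠ ⊥ ∧ Submodule.IsPrincipal I ∧ (Ideal.absNorm I : ℝ) ≤ x} : ℝ) ≤
            7 * ((Real.log a) ^ 2 / (a : ℝ) ^ 2) * x := by
  intro a ha K _ _ σ ρK hσ hgen hmax x hx
  obtain ⟨B, rfl, hB⟩ := exists_cube_root ha hx
  obtain ⟨τ, hτ, hnorm⟩ := exists_embeddings ha hσ hgen
  obtain ⟨φ, hφ, hφ0, hval⟩ := exists_coordinates ha hσ hmax hτ
  exact card_principal_ideals_bounds ha hnorm hφ hφ0 hval hB
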